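/- Let Γ ⊂ ℂ be a quasismooth Jordan curve, let ν ∈ A∞(Γ) be such that dν = w ds for a Borel weight w : Γ → [0,∞), and let 1 ≤ p < q < ∞. Then there exist a constant c₃ > 0 depending only on Γ, p, q, λ_ν and an integer n₁ = n₁(Γ) such that for every n > n₁ and every polynomial p_n ∈ ℙ_n, (∫_Γ |p_n|^q w ds)^{1/q} ≤ c₃ · d(Γ, Γ_{1/n})^{1/q − 1/p} · (∫_Γ |p_n|^p w^{p/q} ds)^{1/p}. -/

import Mathlib

open MeasureTheory Metric Set Filter Bornology Complex
open scoped ENNReal NNReal Topology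

noncomputable section

/-- `Γ` is a Jordan curve: the image of an injective continuous map of the unit circle. -/
def IsJordanCurve (Γ : Set ℂ) : Prop :=
  ∃ γ : ℂ → ℂ, ContinuousOn γ (Metric.sphere (0:ℂ) 1) ∧
    Set.InjOn γ (Metric.sphere (0:ℂ) 1) ∧ Γ = γ '' (Metric.sphere (0:ℂ) 1)

/-- A (closed) subarc of `Γ`: a closed connected subset. -/
def IsSubarc (Γ J : Set ℂ) : Prop :=
  J ⊆ Γ ∧ IsClosed J ∧ IsPreconnected J

/-- `|Γ(z₁,z₂)|`: the length (1-dimensional Hausdorff measure) of the shorter subarc of `Γ`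
joining `z₁` and `z₂`, described as the infimum of lengths of closed connected subsets of `Γ`
containing both points. -/
def shorterArcLength (Γ : Set ℂ) (z₁ z₂ : ℂ) : ℝ≥0∞ :=
  ⨅ (J : Set ℂ) (_ : IsSubarc Γ J ∧ z₁ ∈ J ∧ z₂ ∈ J), μH[1] J

/-- `J` is (a realization of) the shorter arc `Γ(z₁,z₂)` of `Γ` between `z₁` and `z₂`. -/
def IsShorterArc (Γ : Set ℂ) (z₁ z₂ : ℂ) (J : Set ℂ) : Prop :=
  IsSubarc Γ J ∧ z₁ ∈ J ∧ z₂ ∈ J ∧ μH[1] J = shorterArcLength Γ z₁ z₂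

/-- `Γ` is quasismooth (in the sense of Lavrentiev) with constant `Λ ≥ 1`:
`|Γ(z₁,z₂)| ≤ Λ |z₁ - z₂|`. -/
def IsQuasismooth (Γ : Set ℂ) (Λ : ℝ) : Prop :=
  1 ≤ Λ ∧ ∀ z₁ ∈ Γ, ∀ z₂ ∈ Γ,
    shorterArcLength Γ z₁ z₂ ≤ ENNReal.ofReal (Λ * dist z₁ z₂)

/-- The union of the unbounded connected components of `Γᶜ`; for a Jordan curve `Γ` this is
the (unique) unbounded component `Ω` of the complement of `Γ`. -/
def unboundedComponent (Γ : Set ℂ) : Set ℂ :=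
  {z | z ∉ Γ ∧ ¬ Bornology.IsBounded (connectedComponentIn Γᶜ z)}

/-- `d(A,B) := inf {|z-ζ| : z ∈ A, ζ ∈ B}`. -/
def setDist (A B : Set ℂ) : ℝ := sInf (Set.image2 dist A B)

/-- The exterior `𝔻*` of the closed unit disk (finite part). -/
def extDisk : Set ℂ := {w : ℂ | 1 < ‖w‖}

/-- `Φ` is the conformal (holomorphic bijective) map of `Ω` onto `𝔻* = {|w| > 1}` normalized
by `Φ(∞) = ∞` and `Φ'(∞) := lim_{z→∞} Φ(z)/z > 0`. -/
def IsExtConformal (Ω : Set ℂ) (Φ : ℂ → ℂ) : Prop :=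
  DifferentiableOn ℂ Φ Ω ∧ Set.BijOn Φ Ω extDisk ∧
    ∃ c : ℝ, 0 < c ∧
      Filter.Tendsto (fun z => Φ z / z) (Bornology.cobounded ℂ) (nhds (c : ℂ))

/-- `Φ` additionally extends to a homeomorphism of `closure Ω` onto `{|w| ≥ 1}`. -/
def IsExtConformalClosure (Ω : Set ℂ) (Φ : ℂ → ℂ) : Prop :=
  IsExtConformal Ω Φ ∧ ContinuousOn Φ (closure Ω) ∧
    Set.BijOn Φ (closure Ω) {w : ℂ | 1 ≤ ‖w‖}

/-- The level curve `Γ_δ := {ζ ∈ Ω : |Φ(ζ)| = 1 + δ}`. -/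
def levelCurve (Ω : Set ℂ) (Φ : ℂ → ℂ) (δ : ℝ) : Set ℂ :=
  {ζ ∈ Ω | ‖Φ ζ‖ = 1 + δ}

/-- `ρ_δ(z) := d({z}, Γ_δ)`. -/
def rho (Ω : Set ℂ) (Φ : ℂ → ℂ) (δ : ℝ) (z : ℂ) : ℝ :=
  Metric.infDist z (levelCurve Ω Φ δ)

/-- `ν ∈ A∞(Γ)` with constant `lam ≥ 1`: `ν(J) ≤ lam · ν(S)` for every subarc `J ⊂ Γ` and
every Borel set `S ⊂ J` with `|J| ≤ 2|S|`. -/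
def IsAInftyMeasure (Γ : Set ℂ) (ν : MeasureTheory.Measure ℂ) (lam : ℝ) : Prop :=
  1 ≤ lam ∧ ∀ J S : Set ℂ, IsSubarc Γ J → S ⊆ J → MeasurableSet S →
    μH[1] J ≤ 2 * μH[1] S → ν J ≤ ENNReal.ofReal lam * ν S

section ExteriorMap

theorem isOpen_unboundedComponent {Γ : Set ℂ} (hΓ : IsCompact Γ) :
    IsOpen (unboundedComponent Γ) := by
  rw [isOpen_iff_mem_nhds]
  rintro z ⟨hz, hb⟩
  have ho : IsOpen (connectedComponentIn Γᶜ z) := hΓ.isClosed.isOpen_compl.connectedComponentIn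
  refine Filter.mem_of_superset (ho.mem_nhds (mem_connectedComponentIn hz)) fun y hy => ?_
  exact ⟨connectedComponentIn_subset _ _ hy, by rwa [← connectedComponentIn_eq hy]⟩

theorem frontier_connectedComponentIn_subset {Γ : Set ℂ} (hΓ : IsCompact Γ) (x : ℂ) :
    frontier (connectedComponentIn Γᶜ x) ⊆ Γ := by
  intro z hz
  by_contra hzΓ
  have ho := hΓ.isClosed.isOpen_compl
  rw [ho.connectedComponentIn.frontier_eq] at hz
  obtain ⟨y, hy1, hy2⟩ := mem_closure_iff.1 hz.1 _ (ho.connectedComponentIn (x := z))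
    (mem_connectedComponentIn hzΓ)
  apply hz.2
  rw [connectedComponentIn_eq hy2, ← connectedComponentIn_eq hy1]
  exact mem_connectedComponentIn hzΓ

theorem frontier_unboundedComponent_subset {Γ : Set ℂ} (hΓ : IsCompact Γ) :
    frontier (unboundedComponent Γ) ⊆ Γ := by
  intro z hz
  by_contra hzΓ
  have ho := hΓ.isClosed.isOpen_compl
  rw [(isOpen_unboundedComponent hΓ).frontier_eq] at hz
  obtain ⟨y, hy1, hy2⟩ := mem_closure_iff.1 hz.1 _ (ho.connectedComponentIn (x := z))
    (mem_connectedComponentIn hzΓ)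
  apply hz.2
  exact ⟨hzΓ, by rw [connectedComponentIn_eq hy1]; exact hy2.2⟩

theorem isPreconnected_setOf_lt_norm {R : ℝ} (hR : 0 < R) :
    IsPreconnected {z : ℂ | R < ‖z‖} := by
  have : {z : ℂ | R < ‖z‖} = Complex.exp '' {z : ℂ | Real.log R < z.re} := by
    ext z
    constructor
    · intro hz
      have hz0 : z ≠ 0 := by
        rintro rfl
        simp only [mem_ofPred_eq, norm_zero] at hz
        exact absurd hz (not_lt.2 hR.le)
      refine ⟨Complex.log z, ?_, Complex.exp_log hz0⟩
      rw [mem_ofPred_eq, Complex.log_re]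
      exact Real.log_lt_log hR hz
    · rintro ⟨y, hy, rfl⟩
      rw [mem_ofPred_eq, Complex.norm_exp]
      exact (Real.log_lt_iff_lt_exp hR).1 hy
  rw [this]
  exact ((convex_halfSpace_re_gt _).isPreconnected).image _ Complex.continuous_exp.continuousOn

theorem exists_forall_lt_norm_mem_unboundedComponent {Γ : Set ℂ} (hΓ : IsCompact Γ) :
    ∃ R > 0, ∀ z : ℂ, R < ‖z‖ → z ∈ unboundedComponent Γ := by
  obtain ⟨R, hR, hsub⟩ := hΓ.isBounded.exists_pos_norm_le
  refine ⟨R, hR, fun z hz => ?_⟩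
  have hz' : ∀ y : ℂ, R < ‖y‖ → y ∈ Γᶜ := fun y hy hyΓ => absurd (hsub y hyΓ) (not_le.2 hy)
  refine ⟨hz' z hz, fun hb => ?_⟩
  have hs : {y : ℂ | R < ‖y‖} ⊆ connectedComponentIn Γᶜ z :=
    (isPreconnected_setOf_lt_norm hR).subset_connectedComponentIn hz hz'
  obtain ⟨T, hT, hTs⟩ := (hb.subset hs).exists_pos_norm_le
  have h1 : ‖((R + T : ℝ) : ℂ)‖ = R + T := by
    rw [Complex.norm_real, Real.norm_of_nonneg (by positivity)]
  have := hTs ((R + T : ℝ) : ℂ) (by rw [mem_ofPred_eq, h1]; linarith)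
  rw [h1] at this
  linarith

variable {Γ : Set ℂ} {Φ : ℂ → ℂ}

theorem IsExtConformal.exists_norm_le (hΓ : IsCompact Γ)
    (hΦ : IsExtConformal (unboundedComponent Γ) Φ) (r : ℝ) :
    ∃ R, ∀ z ∈ unboundedComponent Γ, ‖z‖ ≤ r → ‖Φ z‖ ≤ R := by
  obtain ⟨hd, hbij, c, hc, hlim⟩ := hΦ
  obtain ⟨R₀, hR₀, hΩ⟩ := exists_forall_lt_norm_mem_unboundedComponent hΓ
  have hopen := isOpen_unboundedComponent hΓ
  set g : ℂ → ℂ := fun z => if z = 0 then 0 else (Φ z⁻¹)⁻¹ with hg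
  set r' := max r R₀ with hr'
  have hr'0 : 0 < r' := lt_of_lt_of_le hR₀ (le_max_right _ _)
  have hinv : ∀ z : ℂ, z ≠ 0 → ‖z‖ < r'⁻¹ → r' < ‖z⁻¹‖ := by
    intro z hz hzr
    rw [norm_inv]
    exact (lt_inv_comm₀ hr'0 (norm_pos_iff.2 hz)).2 hzr
  have hmem : ∀ z : ℂ, z ≠ 0 → ‖z‖ < r'⁻¹ → z⁻¹ ∈ unboundedComponent Γ := fun z hz hzr =>
    hΩ _ (lt_of_le_of_lt (le_max_right _ _) (hinv z hz hzr))
  have hball : ball (0:ℂ) r'⁻¹ ∈ nhds (0:ℂ) := ball_mem_nhds _ (inv_pos.2 hr'0)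
  have hne : ∀ z ∈ unboundedComponent Γ, Φ z ≠ 0 := by
    intro z hz h0
    have : 1 < ‖Φ z‖ := hbij.mapsTo hz
    rw [h0, norm_zero] at this
    linarith
  have han : AnalyticAt ℂ g 0 := by
    apply Complex.analyticAt_of_differentiable_on_punctured_nhds_of_continuousAt
    · filter_upwards [nhdsWithin_le_nhds hball, self_mem_nhdsWithin] with z hz hz0
      have hz0' : z ≠ 0 := hz0
      have hm := hmem z hz0' (by simpa using hz)
      have h1 : DifferentiableAt ℂ (fun z => (Φ z⁻¹)⁻¹) z := by
        refine DifferentiableAt.inv ?_ (hne _ hm)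
        exact DifferentiableAt.comp z (hd.differentiableAt (hopen.mem_nhds hm))
          (differentiableAt_inv hz0')
      refine h1.congr_of_eventuallyEq ?_
      filter_upwards [isOpen_ne.mem_nhds hz0'] with y hy
      simp only [hg]
      rw [if_neg hy]
    · rw [continuousAt_iff_punctured_nhds]
      have h1 : Tendsto (fun z : ℂ => z * ((Φ z⁻¹) / z⁻¹)⁻¹) (𝓝[≠] 0) (𝓝 (0 * (c:ℂ)⁻¹)) := by
        refine Tendsto.mul (tendsto_nhdsWithin_of_tendsto_nhds tendsto_id) ?_
        refine Tendsto.inv₀ (hlim.comp tendsto_inv₀_nhdsNE_zero) ?_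
        exact_mod_cast hc.ne'
      have h2 : g 0 = 0 * (c:ℂ)⁻¹ := by simp [hg]
      rw [h2]
      refine h1.congr' ?_
      filter_upwards [self_mem_nhdsWithin] with z hz
      have hz0' : z ≠ 0 := hz
      simp only [hg]
      rw [if_neg hz0', div_inv_eq_mul, mul_inv]
      field_simp
  rcases han.eventually_constant_or_nhds_le_map_nhds with h | h
  · exfalso
    have h3 : ∀ᶠ z in 𝓝[≠] (0:ℂ), False := by
      filter_upwards [nhdsWithin_le_nhds hball, self_mem_nhdsWithin, nhdsWithin_le_nhds h]
        with z hz hz0 hgz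
      have hz0' : z ≠ 0 := hz0
      have hm := hmem z hz0' (by simpa using hz)
      simp only [hg] at hgz
      rw [if_neg hz0', if_pos trivial] at hgz
      exact hne _ hm (inv_eq_zero.1 hgz)
    exact h3.exists.elim fun _ h => h
  · have h0 : g 0 = 0 := by simp [hg]
    rw [h0] at h
    have h4 := h (Filter.image_mem_map hball)
    obtain ⟨ε, hε, hεs⟩ := Metric.mem_nhds_iff.1 h4
    refine ⟨ε⁻¹, fun ζ hζ hζr => ?_⟩
    by_contra hlt
    push Not at hlt
    have h5 : (Φ ζ)⁻¹ ∈ ball (0:ℂ) ε := by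
      rw [mem_ball_zero_iff, norm_inv]
      exact inv_lt_of_inv_lt₀ hε hlt
    obtain ⟨z, hz, hgz⟩ := hεs h5
    have hz0 : z ≠ 0 := by
      rintro rfl
      rw [h0] at hgz
      exact hne _ hζ (inv_eq_zero.1 hgz.symm)
    simp only [hg] at hgz
    rw [if_neg hz0] at hgz
    have hz' : ‖z‖ < r'⁻¹ := by simpa using hz
    have h6 := hbij.injOn (hmem z hz0 hz') hζ (inv_injective hgz)
    have h7 := hinv z hz0 hz'
    rw [h6] at h7
    exact absurd (hζr.trans (le_max_left r R₀)) (not_le.2 h7)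

theorem IsExtConformal.nhds_le_map (hΓ : IsCompact Γ)
    (hΦ : IsExtConformal (unboundedComponent Γ) Φ) {z : ℂ} (hz : z ∈ unboundedComponent Γ) :
    𝓝 (Φ z) ≤ Filter.map Φ (𝓝 z) := by
  have hopen := isOpen_unboundedComponent hΓ
  have han : AnalyticAt ℂ Φ z := hΦ.1.analyticAt (hopen.mem_nhds hz)
  refine han.eventually_constant_or_nhds_le_map_nhds.resolve_left fun h => ?_
  have h3 : ∀ᶠ y in 𝓝[≠] z, False := by
    filter_upwards [nhdsWithin_le_nhds h, self_mem_nhdsWithin,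
      nhdsWithin_le_nhds (hopen.mem_nhds hz)] with y hy hyz hyΩ
    exact hyz (hΦ.2.1.injOn hyΩ hz hy)
  exact h3.exists.elim fun _ h => h

theorem IsExtConformal.closure_subset (hΓ : IsCompact Γ)
    (hΦ : IsExtConformal (unboundedComponent Γ) Φ) {δ : ℝ} (hδ : 0 < δ) :
    closure {z ∈ unboundedComponent Γ | 1 + δ ≤ ‖Φ z‖} ⊆ unboundedComponent Γ := by
  intro z hz
  have hopen := isOpen_unboundedComponent hΓ
  obtain ⟨x, hxS, hx⟩ := mem_closure_iff_seq_limit.1 hz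
  obtain ⟨r, hr⟩ : ∃ r, ∀ k, ‖x k‖ ≤ r := by
    obtain ⟨r, hr⟩ := (Metric.isBounded_range_of_tendsto x hx).exists_norm_le
    exact ⟨r, fun k => hr _ ⟨k, rfl⟩⟩
  obtain ⟨R, hR⟩ := hΦ.exists_norm_le hΓ r
  have hK : IsCompact {w : ℂ | 1 + δ ≤ ‖w‖ ∧ ‖w‖ ≤ R} := by
    have : {w : ℂ | 1 + δ ≤ ‖w‖ ∧ ‖w‖ ≤ R} = {w : ℂ | 1 + δ ≤ ‖w‖} ∩ closedBall 0 R := by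
      ext w; simp
    rw [this]
    exact (isCompact_closedBall _ _).inter_left (isClosed_le continuous_const continuous_norm)
  obtain ⟨w, hw, φ, hφ, hlim⟩ := hK.tendsto_subseq (x := fun k => Φ (x k))
    (fun k => ⟨(hxS k).2, hR _ (hxS k).1 (hr k)⟩)
  obtain ⟨z', hz', rfl⟩ := hΦ.2.1.surjOn (show w ∈ extDisk by
    change 1 < ‖w‖; linarith [hw.1])
  have hx' : Tendsto (x ∘ φ) atTop (𝓝 z') := by
    intro U hU
    have h1 := hΦ.nhds_le_map hΓ hz' (Filter.image_mem_map
      (Filter.inter_mem hU (hopen.mem_nhds hz')))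
    rw [Filter.mem_map]
    filter_upwards [Filter.mem_map.1 (hlim h1)] with k hk
    obtain ⟨y, ⟨hyU, hyΩ⟩, hy⟩ := hk
    have := hΦ.2.1.injOn hyΩ (hxS (φ k)).1 hy
    change x (φ k) ∈ U
    rwa [← this]
  rw [tendsto_nhds_unique (hx.comp hφ.tendsto_atTop) hx']
  exact hz'

theorem IsExtConformal.exists_norm_le_of_norm_map_le
    (hΦ : IsExtConformal (unboundedComponent Γ) Φ) (T : ℝ) :
    ∃ R, ∀ z, ‖Φ z‖ ≤ T → ‖z‖ ≤ R := by
  obtain ⟨-, -, c, hc, hlim⟩ := hΦ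
  have h1 : ∀ᶠ z in Bornology.cobounded ℂ, c / 2 < ‖Φ z / z‖ :=
    hlim.norm.eventually (lt_mem_nhds (by
      rw [Complex.norm_real, Real.norm_of_nonneg hc.le]; linarith))
  obtain ⟨R, -, hR⟩ := ((Metric.hasBasis_cobounded_compl_closedBall (0:ℂ)).eventually_iff).1 h1
  refine ⟨max (max R 0) (2 * T / c), fun z hz => ?_⟩
  by_contra hlt
  push Not at hlt
  have h2 : R < ‖z‖ := lt_of_le_of_lt ((le_max_left _ _).trans (le_max_left _ _)) hlt
  have h0 : 0 < ‖z‖ := lt_of_le_of_lt ((le_max_right _ _).trans (le_max_left _ _)) hlt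
  have h3 : 2 * T / c < ‖z‖ := lt_of_le_of_lt (le_max_right _ _) hlt
  have h4 := hR (x := z) (by simpa using h2)
  rw [norm_div, lt_div_iff₀ h0] at h4
  rw [div_lt_iff₀ hc] at h3
  nlinarith

theorem IsExtConformal.continuousOn_norm (hΦ : IsExtConformal (unboundedComponent Γ) Φ) :
    ContinuousOn (fun z => ‖Φ z‖) (unboundedComponent Γ) := hΦ.1.continuousOn.norm

theorem IsExtConformal.isClosed_levelCurve (hΓ : IsCompact Γ)
    (hΦ : IsExtConformal (unboundedComponent Γ) Φ) {δ : ℝ} (hδ : 0 < δ) :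
    IsClosed (levelCurve (unboundedComponent Γ) Φ δ) := by
  refine isClosed_of_closure_subset fun z hz => ?_
  have hzΩ : z ∈ unboundedComponent Γ :=
    hΦ.closure_subset hΓ hδ (closure_mono (fun y hy => show _ ∧ _ from ⟨hy.1, hy.2.ge⟩) hz)
  refine ⟨hzΩ, ?_⟩
  have hc : ContinuousAt (fun z => ‖Φ z‖) z :=
    hΦ.continuousOn_norm.continuousAt ((isOpen_unboundedComponent hΓ).mem_nhds hzΩ)
  obtain ⟨x, hxS, hx⟩ := mem_closure_iff_seq_limit.1 hz
  have h1 : Tendsto (fun k => ‖Φ (x k)‖) atTop (𝓝 ‖Φ z‖) := hc.tendsto.comp hx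
  have h2 : (fun k => ‖Φ (x k)‖) = fun _ => 1 + δ := funext fun k => (hxS k).2
  rw [h2] at h1
  exact tendsto_nhds_unique h1 tendsto_const_nhds

theorem IsExtConformal.levelCurve_nonempty (hΦ : IsExtConformal (unboundedComponent Γ) Φ)
    {δ : ℝ} (hδ : 0 < δ) : (levelCurve (unboundedComponent Γ) Φ δ).Nonempty := by
  have hn : ‖((1 + δ : ℝ) : ℂ)‖ = 1 + δ := by
    rw [Complex.norm_real, Real.norm_of_nonneg (by positivity)]
  obtain ⟨z, hz, hzw⟩ := hΦ.2.1.surjOn (show ((1 + δ : ℝ) : ℂ) ∈ extDisk by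
    change 1 < ‖((1 + δ : ℝ) : ℂ)‖; rw [hn]; linarith)
  exact ⟨z, hz, by rw [hzw, hn]⟩

theorem setDist_le_dist {A B : Set ℂ} {a b : ℂ} (ha : a ∈ A) (hb : b ∈ B) :
    setDist A B ≤ dist a b :=
  csInf_le ⟨0, by rintro _ ⟨x, -, y, -, rfl⟩; exact dist_nonneg⟩ ⟨a, ha, b, hb, rfl⟩

theorem IsExtConformal.setDist_pos (hΓ : IsCompact Γ) (hne : Γ.Nonempty)
    (hΦ : IsExtConformal (unboundedComponent Γ) Φ) {δ : ℝ} (hδ : 0 < δ) :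
    0 < setDist Γ (levelCurve (unboundedComponent Γ) Φ δ) := by
  have hdisj : Disjoint Γ (levelCurve (unboundedComponent Γ) Φ δ) :=
    Set.disjoint_left.2 fun z hz hz' => hz'.1.1 hz
  obtain ⟨r, hr, h⟩ := hdisj.exists_cthickenings hΓ (hΦ.isClosed_levelCurve hΓ hδ)
  refine lt_of_lt_of_le hr (le_csInf (hne.image2 (hΦ.levelCurve_nonempty hδ)) ?_)
  rintro _ ⟨x, hx, y, hy, rfl⟩
  by_contra hlt
  push Not at hlt
  refine Set.disjoint_left.1 h ?_ (self_subset_cthickening _ hy)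
  exact mem_cthickening_of_dist_le y x r Γ hx (by rw [dist_comm]; exact hlt.le)

theorem IsExtConformal.exists_setDist_le (hne : Γ.Nonempty)
    (hΦ : IsExtConformal (unboundedComponent Γ) Φ) :
    ∃ D > 0, ∀ δ, 0 < δ → δ ≤ 1 → setDist Γ (levelCurve (unboundedComponent Γ) Φ δ) ≤ D := by
  obtain ⟨R, hR⟩ := hΦ.exists_norm_le_of_norm_map_le 2
  obtain ⟨x, hx⟩ := hne
  refine ⟨|R| + ‖x‖ + 1, by positivity, fun δ hδ hδ1 => ?_⟩
  obtain ⟨z, hz⟩ := hΦ.levelCurve_nonempty hδ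
  have h1 : ‖z‖ ≤ R := hR z (by rw [hz.2]; linarith)
  have h2 := setDist_le_dist hx hz
  have h3 : dist x z ≤ ‖x‖ + ‖z‖ := dist_le_norm_add_norm x z
  linarith [le_abs_self R]

theorem IsExtConformal.norm_le_of_dist_lt (hΓ : IsCompact Γ)
    (hΦ : IsExtConformal (unboundedComponent Γ) Φ) {δ : ℝ} (hδ : 0 < δ) {ζ z₀ : ℂ}
    (hζ : ζ ∈ unboundedComponent Γ) (hz₀ : z₀ ∈ Γ)
    (hd : dist ζ z₀ < setDist Γ (levelCurve (unboundedComponent Γ) Φ δ)) :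
    ‖Φ ζ‖ ≤ 1 + δ := by
  by_contra hlt
  push Not at hlt
  set A := {z ∈ unboundedComponent Γ | 1 + δ < ‖Φ z‖} with hA
  have hopen := isOpen_unboundedComponent hΓ
  have hAo : IsOpen A := hΦ.continuousOn_norm.isOpen_inter_preimage hopen isOpen_Ioi
  obtain ⟨y, hyseg, hyA⟩ : (segment ℝ ζ z₀ ∩ frontier A).Nonempty := by
    by_contra hemp
    rw [Set.not_nonempty_iff_eq_empty, ← Set.disjoint_iff_inter_eq_empty] at hemp
    have hpre : IsPreconnected (segment ℝ ζ z₀) := (convex_segment ζ z₀).isPreconnected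
    have := hpre.subset_left_of_subset_union hAo isClosed_closure.isOpen_compl (u := A)
      (v := (closure A)ᶜ) (Set.disjoint_left.2 fun x hx hx' => hx' (subset_closure hx)) ?_
      ⟨ζ, left_mem_segment ℝ ζ z₀, hζ, hlt⟩
    · exact (this (right_mem_segment ℝ ζ z₀)).1.1 hz₀
    · intro x hx
      have hxf := Set.disjoint_left.1 hemp hx
      rw [hAo.frontier_eq] at hxf
      by_cases hxA : x ∈ A
      · exact Or.inl hxA
      · exact Or.inr fun hxc => hxf ⟨hxc, hxA⟩
  rw [hAo.frontier_eq] at hyA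
  have hyΩ : y ∈ unboundedComponent Γ :=
    hΦ.closure_subset hΓ hδ (closure_mono (fun y hy => show _ ∧ _ from ⟨hy.1, hy.2.le⟩) hyA.1)
  have hyle : ‖Φ y‖ ≤ 1 + δ := by
    by_contra h
    exact hyA.2 ⟨hyΩ, not_le.1 h⟩
  have hyge : 1 + δ ≤ ‖Φ y‖ := by
    have hc : ContinuousAt (fun z => ‖Φ z‖) y :=
      hΦ.continuousOn_norm.continuousAt (hopen.mem_nhds hyΩ)
    obtain ⟨x, hxS, hx⟩ := mem_closure_iff_seq_limit.1 hyA.1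
    exact ge_of_tendsto' (hc.tendsto.comp hx) fun k => (hxS k).2.le
  have h1 := setDist_le_dist hz₀ (b := y) (show y ∈ levelCurve (unboundedComponent Γ) Φ δ from
    ⟨hyΩ, le_antisymm hyle hyge⟩)
  have h2 : dist z₀ y ≤ dist ζ z₀ := by
    rw [dist_comm]
    have := (convex_closedBall z₀ (dist ζ z₀)).segment_subset (x := ζ) (y := z₀)
      (by simp) (by simp) hyseg
    simpa using this
  linarith

end ExteriorMap

section LocalBernsteinWalsh

/-- Maximum principle for a function dominated by a continuous majorant near the boundary. -/
theorem norm_le_of_continuousOn_majorant {U : Set ℂ} (hU : IsOpen U) {f : ℂ → ℂ} {G : ℂ → ℝ}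
    {B : ℝ} (hf : DifferentiableOn ℂ f U) (hG : ContinuousOn G (closure U))
    (hfG : ∀ z ∈ U, ‖f z‖ ≤ G z) (hfr : ∀ z ∈ frontier U, G z ≤ B)
    (hinf : ∀ᶠ z in Bornology.cobounded ℂ, z ∈ U → ‖f z‖ ≤ B) {z : ℂ} (hz : z ∈ U) :
    ‖f z‖ ≤ B := by
  refine le_of_forall_pos_le_add fun ε hε => ?_
  obtain ⟨R, -, hR⟩ := ((Metric.hasBasis_cobounded_compl_ball (0:ℂ)).eventually_iff).1 hinf
  by_cases hzR : z ∈ ball (0:ℂ) R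
  swap
  · exact (hR hzR hz).trans (by linarith)
  by_cases hzG : B + ε < G z
  swap
  · exact (hfG z hz).trans (not_lt.1 hzG)
  set V := (U ∩ G ⁻¹' Ioi (B + ε)) ∩ ball 0 R with hV
  have hVo : IsOpen V :=
    ((hG.mono subset_closure).isOpen_inter_preimage hU isOpen_Ioi).inter isOpen_ball
  have hK : IsClosed (closure U ∩ G ⁻¹' Ici (B + ε)) :=
    hG.preimage_isClosed_of_isClosed isClosed_closure isClosed_Ici
  have hVK : closure V ⊆ closure U ∩ G ⁻¹' Ici (B + ε) :=
    closure_minimal (fun y hy => ⟨subset_closure hy.1.1,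
      mem_preimage.2 (mem_Ici.2 (mem_Ioi.1 (mem_preimage.1 hy.1.2)).le)⟩) hK
  have hVU : closure V ⊆ U := fun y hy => by
    by_contra hyU
    have h1 := hVK hy
    have h2 : G y ≤ B := hfr y (by rw [hU.frontier_eq]; exact ⟨h1.1, hyU⟩)
    have h3 : B + ε ≤ G y := h1.2
    linarith
  refine Complex.norm_le_of_forall_mem_frontier_norm_le (U := V)
    (isBounded_ball.subset inter_subset_right) (hf.mono hVU).diffContOnCl ?_
    (subset_closure ⟨⟨hz, hzG⟩, hzR⟩)
  intro y hy
  rw [hVo.frontier_eq] at hy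
  have hyU := hVU hy.1
  by_cases hyR : y ∈ ball (0:ℂ) R
  · refine (hfG y hyU).trans ?_
    by_contra h
    exact hy.2 ⟨⟨hyU, not_le.1 h⟩, hyR⟩
  · exact (hR hyR hyU).trans (by linarith)

theorem exists_norm_eval_le_mul_pow {n : ℕ} {P : Polynomial ℂ} (hP : P.natDegree ≤ n) :
    ∃ K ≥ 0, ∀ z : ℂ, 1 ≤ ‖z‖ → ‖P.eval z‖ ≤ K * ‖z‖ ^ n := by
  refine ⟨∑ i ∈ Finset.range (n + 1), ‖P.coeff i‖, Finset.sum_nonneg fun _ _ => norm_nonneg _,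
    fun z hz => ?_⟩
  rw [Polynomial.eval_eq_sum_range' (Nat.lt_succ_of_le hP), Finset.sum_mul]
  refine (norm_sum_le _ _).trans (Finset.sum_le_sum fun i hi => ?_)
  rw [norm_mul, norm_pow]
  have hin : i ≤ n := Nat.lt_succ_iff.1 (Finset.mem_range.1 hi)
  gcongr

theorem dist_eval_le_of_forall_ball {P : Polynomial ℂ} {c : ℂ} {r M : ℝ}
    (hM : ∀ ζ ∈ ball c r, ‖P.eval ζ‖ ≤ M) {z : ℂ} (hz : z ∈ ball c r) :
    ‖P.eval z‖ ≤ ‖P.eval c‖ + 2 * M / r * dist z c ∧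
      ‖P.eval c‖ ≤ ‖P.eval z‖ + 2 * M / r * dist z c := by
  have hr : 0 < r := pos_of_mem_ball hz
  have h := Complex.dist_le_div_mul_dist_of_mapsTo_ball (f := fun ζ => P.eval ζ) (R₂ := 2 * M)
    P.differentiable.differentiableOn (c := c) (z := z) (R₁ := r) ?_ hz
  · rw [dist_eq_norm] at h
    constructor
    · linarith [norm_le_norm_add_norm_sub' (P.eval z) (P.eval c)]
    · have := norm_le_norm_add_norm_sub' (P.eval c) (P.eval z)
      rw [norm_sub_rev] at this
      linarith
  · intro ζ hζ
    rw [mem_closedBall, dist_eq_norm]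
    have := norm_sub_le (P.eval ζ) (P.eval c)
    linarith [hM ζ hζ, hM c (mem_ball_self hr)]

/-- A maximum principle for `P ^ N` divided by a product with poles at finitely many points of
the boundary. -/
theorem norm_eval_pow_le_of_poles {Γ U : Set ℂ} (hU : IsOpen U) (hUΓ : frontier U ⊆ Γ)
    {Ψ : ℂ → ℂ} (hΨ : DifferentiableOn ℂ Ψ U) (hΨ1 : ∀ z ∈ U, 1 ≤ ‖Ψ z‖) {n : ℕ}
    {P : Polynomial ℂ} {K : ℝ}
    (hK : ∀ᶠ z in Bornology.cobounded ℂ, z ∈ U → ‖P.eval z‖ ≤ K * ‖Ψ z‖ ^ n)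
    {N s : ℕ} (hN : 1 ≤ N) (hs : 1 ≤ s) (t : Fin N → ℂ) {h r B : ℝ} (hh : 0 < h) (hr : 0 < r)
    (hB : 0 < B)
    (h1 : ∀ z ∈ Γ, (∀ j, r ≤ dist z (t j)) →
      ‖P.eval z‖ ^ N ≤ B * ∏ j, (dist z (t j) / h) ^ s)
    (h2 : ∀ z, (∀ j, r ≤ dist z (t j)) → (∃ j, dist z (t j) = r) →
      ‖P.eval z‖ ^ N ≤ B * ∏ j, (dist z (t j) / h) ^ s)
    {z : ℂ} (hz : z ∈ U) (hzr : ∀ j, r < dist z (t j)) :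
    ‖P.eval z‖ ^ N ≤ B * (∏ j, (dist z (t j) / h) ^ s) * (‖Ψ z‖ ^ n) ^ N := by
  set H : ℂ → ℂ := fun z => ∏ j, ((z - t j) / h) ^ s with hH
  have hHn : ∀ z, ‖H z‖ = ∏ j, (dist z (t j) / h) ^ s := by
    intro z
    rw [hH, norm_prod]
    refine Finset.prod_congr rfl fun j _ => ?_
    rw [norm_pow, norm_div, Complex.norm_real, Real.norm_of_nonneg hh.le, dist_eq_norm]
  have hHpos : ∀ z, (∀ j, r ≤ dist z (t j)) → 0 < ‖H z‖ := by
    intro z hz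
    rw [hHn]
    exact Finset.prod_pos fun j _ => pow_pos (div_pos (hr.trans_le (hz j)) hh) _
  set F : Set ℂ := {z | ∀ j, r < dist z (t j)} with hF
  have hFo : IsOpen F := by
    rw [hF]
    simp only [ofPred_forall]
    exact isOpen_iInter_of_finite fun j =>
      isOpen_lt continuous_const (continuous_id.dist continuous_const)
  have hFc : IsClosed {z | ∀ j, r ≤ dist z (t j)} := by
    simp only [ofPred_forall]
    exact isClosed_iInter fun j =>
      isClosed_le continuous_const (continuous_id.dist continuous_const)
  have hcl : closure (U ∩ F) ⊆ {z | ∀ j, r ≤ dist z (t j)} :=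
    closure_minimal (fun y hy j => (hy.2 j).le) hFc
  have hHd : Differentiable ℂ H := by
    rw [hH]
    fun_prop
  have hHc : Continuous H := hHd.continuous
  have key := norm_le_of_continuousOn_majorant (U := U ∩ F) (hU.inter hFo)
    (f := fun z => P.eval z ^ N / (H z * (Ψ z ^ n) ^ N)) (G := fun z => ‖P.eval z‖ ^ N / ‖H z‖)
    (B := B) ?_ ?_ ?_ ?_ ?_ (z := z) ⟨hz, hzr⟩
  · have hΨp : 0 < ‖Ψ z‖ := lt_of_lt_of_le one_pos (hΨ1 z hz)
    rw [norm_div, norm_mul, norm_pow, norm_pow, norm_pow, div_le_iff₀ (mul_pos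
      (hHpos z fun j => (hzr j).le) (by positivity)), hHn] at key
    linarith
  · intro y hy
    have hΨp : Ψ y ≠ 0 := norm_pos_iff.1 (lt_of_lt_of_le one_pos (hΨ1 y hy.1))
    refine DifferentiableWithinAt.div ?_ ?_ ?_
    · exact (P.differentiable.pow N).differentiableAt.differentiableWithinAt
    · exact hHd.differentiableAt.differentiableWithinAt.mul
        ((((hΨ y hy.1).mono inter_subset_left).pow n).pow N)
    · exact mul_ne_zero (norm_pos_iff.1 (hHpos y fun j => (hy.2 j).le)) (by positivity)
  · refine ContinuousOn.div (by fun_prop) (by fun_prop) fun y hy => ?_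
    exact (hHpos y (hcl hy)).ne'
  · intro y hy
    have hp := hHpos y fun j => (hy.2 j).le
    rw [norm_div, norm_mul, norm_pow, norm_pow, norm_pow]
    refine div_le_div_of_nonneg_left (by positivity) hp ?_
    exact le_mul_of_one_le_right hp.le (one_le_pow₀ (one_le_pow₀ (hΨ1 y hy.1)))
  · intro y hy
    rw [(hU.inter hFo).frontier_eq] at hy
    have hyr := hcl hy.1
    rw [div_le_iff₀ (hHpos y hyr), hHn]
    by_cases hyU : y ∈ U
    · refine h2 y hyr ?_
      by_contra hne
      push Not at hne
      exact hy.2 ⟨hyU, fun j => lt_of_le_of_ne (hyr j) (hne j).symm⟩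
    · refine h1 y (hUΓ ?_) hyr
      rw [hU.frontier_eq]
      exact ⟨closure_mono inter_subset_left hy.1, hyU⟩
  · set T : ℝ := max 1 (K ^ N / B) with hT
    have hfar : ∀ᶠ y in Bornology.cobounded ℂ, ∀ j, h * T ≤ dist y (t j) := by
      rw [Filter.eventually_all]
      intro j
      exact (tendsto_dist_right_cobounded_atTop (t j)).eventually_ge_atTop _
    filter_upwards [hK, hfar] with y hyK hyT hyU
    have hp := hHpos y fun j => (hyU.2 j).le
    have hΨp : 0 < ‖Ψ y‖ := lt_of_lt_of_le one_pos (hΨ1 y hyU.1)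
    have hHT : T ≤ ‖H y‖ := by
      rw [hHn]
      calc T ≤ T ^ (s * N) := le_self_pow₀ (le_max_left _ _) (by positivity)
        _ = ∏ _j : Fin N, T ^ s := by simp [pow_mul]
        _ ≤ _ := by
          refine Finset.prod_le_prod (fun j _ => by positivity) fun j _ => ?_
          gcongr
          rw [le_div_iff₀ hh, mul_comm]
          exact hyT j
    have hKB : K ^ N ≤ B * ‖H y‖ := by
      rw [mul_comm, ← div_le_iff₀ hB]
      exact (le_max_right _ _).trans hHT
    rw [norm_div, norm_mul, norm_pow, norm_pow, norm_pow,
      div_le_iff₀ (mul_pos hp (by positivity))]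
    calc ‖P.eval y‖ ^ N ≤ (K * ‖Ψ y‖ ^ n) ^ N := by gcongr; exact hyK hyU.1
      _ = K ^ N * (‖Ψ y‖ ^ n) ^ N := mul_pow _ _ _
      _ ≤ B * ‖H y‖ * (‖Ψ y‖ ^ n) ^ N := by gcongr
      _ = _ := by ring

/-- The radius, relative to the scale, of the discs removed around the poles. -/
def poleRadius (s : ℕ) : ℝ := 1 / (2 * (9 * 64 * 4 ^ s * (8 * s) ^ (2 * s)))

theorem poleRadius_pos {s : ℕ} (hs : 1 ≤ s) : 0 < poleRadius s := by
  have : (0:ℝ) < s := by exact_mod_cast hs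
  unfold poleRadius
  positivity

theorem poleRadius_le {s : ℕ} (hs : 1 ≤ s) : poleRadius s ≤ 1 / (8 * s) := by
  have h1 : (1:ℝ) ≤ s := by exact_mod_cast hs
  unfold poleRadius
  refine one_div_le_one_div_of_le (by positivity) ?_
  have h2 : (8 * s : ℝ) ≤ (8 * s) ^ (2 * s) := le_self_pow₀ (by linarith) (by positivity)
  have h3 : (1:ℝ) ≤ 4 ^ s := one_le_pow₀ (by norm_num)
  nlinarith [mul_le_mul h3 h2 (by positivity) (by positivity)]

theorem mul_pow_two_mul_eq {s : ℕ} {η : ℝ} (hη : 0 < η) (M x : ℝ) :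
    (8 * η * M) ^ (2 * s) * (x ^ s) ^ (2 * s) / η ^ s * (2 ^ s) ^ (2 * s) * 3 ^ (2 * s) =
      (η * (9 * 64 * 4 ^ s * x ^ (2 * s))) ^ s * M ^ (2 * s) := by
  have h4 : (4:ℝ) ^ s = (2 ^ s) ^ 2 := by rw [← pow_mul, mul_comm, pow_mul]; norm_num
  rw [h4, mul_comm 2 s, pow_mul' x s 2]
  simp only [mul_comm s 2]
  rw [pow_mul (8 * η * M), pow_mul (x ^ s), pow_mul (2 ^ s), pow_mul 3, pow_mul M, ← mul_pow,
    ← div_pow, ← mul_pow, ← mul_pow, ← mul_pow]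
  have := hη.ne'
  field_simp
  ring

set_option maxHeartbeats 1000000 in
theorem norm_eval_le_of_isMax {s : ℕ} (hs : 1 ≤ s) {Γ U : Set ℂ} (hΓ : IsPreconnected Γ)
    (hU : IsOpen U) (hUΓ : frontier U ⊆ Γ)
    {Ψ : ℂ → ℂ} (hΨ : DifferentiableOn ℂ Ψ U) (hΨ1 : ∀ z ∈ U, 1 ≤ ‖Ψ z‖) {n : ℕ}
    {P : Polynomial ℂ} {K : ℝ}
    (hK : ∀ᶠ z in Bornology.cobounded ℂ, z ∈ U → ‖P.eval z‖ ≤ K * ‖Ψ z‖ ^ n)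
    {z₀ : ℂ} (hz₀ : z₀ ∈ Γ) {h : ℝ} (hh : 0 < h) (hfar : ∃ z' ∈ Γ, h / 2 ≤ dist z' z₀) {A : ℝ}
    (hA : ∀ z ∈ Γ, ‖P.eval z‖ ≤ A * (1 + dist z z₀ / h) ^ s) {ζ : ℂ}
    (hζ : ζ ∈ closedBall z₀ h) (hmax : ∀ z ∈ closedBall z₀ h, ‖P.eval z‖ ≤ ‖P.eval ζ‖)
    (hζU : ζ ∈ U) (hζΨ : ‖Ψ ζ‖ ^ n ≤ 3) :
    ‖P.eval ζ‖ ≤ 6 * (8 / poleRadius s) ^ s * A := by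
  have hs0 : (1:ℝ) ≤ s := by exact_mod_cast hs
  have hη := poleRadius_pos hs
  have hηle := poleRadius_le hs
  have hηdef : poleRadius s * (9 * 64 * 4 ^ s * (8 * s) ^ (2 * s)) = 1 / 2 := by
    unfold poleRadius
    field_simp
  set η := poleRadius s with hηd
  clear_value η
  have hη8 : η ≤ 1 / 8 := hηle.trans (one_div_le_one_div_of_le (by norm_num) (by linarith))
  set M := ‖P.eval ζ‖ with hM
  have hA0 : 0 ≤ A := by
    have := hA z₀ hz₀
    rw [dist_self, zero_div, add_zero, one_pow, mul_one] at this
    exact (norm_nonneg _).trans this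
  by_contra hlt
  push Not at hlt
  have hM0 : 0 < M := lt_of_le_of_lt (by positivity) hlt
  have h8 : 8 ^ s / η ≤ (8 / η) ^ s := by
    rw [div_pow]
    refine div_le_div_of_nonneg_left (by positivity) (by positivity) ?_
    exact pow_le_of_le_one hη.le (by linarith) (by omega)
  have h28 : (2:ℝ) ^ s ≤ 8 ^ s := by gcongr; norm_num
  have hAM : 2 ^ s * A ≤ 4 * η * M := by
    have e1 : 6 * (8 ^ s / η) * A ≤ M := le_trans (by gcongr) hlt.le
    have e2 : 6 * 8 ^ s * A ≤ M * η := by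
      have := mul_le_mul_of_nonneg_right e1 hη.le
      calc 6 * 8 ^ s * A = 6 * (8 ^ s / η) * A * η := by field_simp
        _ ≤ _ := this
    have e3 : 2 ^ s * A ≤ 8 ^ s * A := by gcongr
    have e4 : 0 ≤ 8 ^ s * A := by positivity
    nlinarith
  set N := 2 * s with hN
  have hN0 : (0:ℝ) < N := by rw [hN]; push_cast; linarith
  have hN2 : (2:ℝ) ≤ N := by rw [hN]; push_cast; linarith
  have hηN : η ≤ 1 / (4 * N) := by
    refine hηle.trans (le_of_eq ?_)
    rw [hN]
    push_cast
    ring_nf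
  have hex : ∀ j : Fin N, ∃ t ∈ Γ, dist t z₀ = ((j:ℕ) + 1) * (h / (2 * N)) := by
    intro j
    obtain ⟨z', hz', hd⟩ := hfar
    have h1 := hΓ.intermediate_value hz₀ hz' (f := fun z => dist z z₀) (by fun_prop)
    rw [dist_self] at h1
    obtain ⟨t, ht, htd⟩ := h1 (show ((j:ℕ) + 1) * (h / (2 * N)) ∈ Icc 0 (dist z' z₀) from
      ⟨by positivity, le_trans (by
        have : ((j:ℕ) + 1 : ℝ) ≤ N := by exact_mod_cast j.2
        calc ((j:ℕ) + 1) * (h / (2 * N)) ≤ N * (h / (2 * N)) := by gcongr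
          _ = h / 2 := by field_simp) hd⟩)
    exact ⟨t, ht, htd⟩
  choose t htΓ htd using hex
  have ht2 : ∀ j, dist (t j) z₀ ≤ h / 2 := by
    intro j
    rw [htd]
    have : ((j:ℕ) + 1 : ℝ) ≤ N := by exact_mod_cast j.2
    calc ((j:ℕ) + 1) * (h / (2 * N)) ≤ N * (h / (2 * N)) := by gcongr
      _ = h / 2 := by field_simp
  have hsep : ∀ j k, j ≠ k → h / (2 * N) ≤ dist (t j) (t k) := by
    intro j k hjk
    have h1 : |dist (t j) z₀ - dist (t k) z₀| ≤ dist (t j) (t k) := abs_dist_sub_le _ _ _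
    refine le_trans ?_ h1
    rw [htd, htd, ← sub_mul, abs_mul, abs_of_pos (show 0 < h / (2 * N) by positivity)]
    refine le_mul_of_one_le_left (by positivity) ?_
    have hne : ((j:ℕ):ℤ) - (k:ℕ) ≠ 0 := by
      intro h0
      apply hjk
      apply Fin.ext
      omega
    have : (1:ℤ) ≤ |((j:ℕ):ℤ) - (k:ℕ)| := Int.one_le_abs hne
    have h2 : ((j:ℕ) + 1 - ((k:ℕ) + 1) : ℝ) = ((((j:ℕ):ℤ) - (k:ℕ) : ℤ) : ℝ) := by
      push_cast; ring
    rw [h2]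
    exact_mod_cast this
  have hPt : ∀ j, ‖P.eval (t j)‖ ≤ 2 ^ s * A := by
    intro j
    refine (hA _ (htΓ j)).trans ?_
    rw [mul_comm]
    gcongr
    have := ht2 j
    have : dist (t j) z₀ / h ≤ 1 := by rw [div_le_one hh]; linarith
    linarith
  have hnear : ∀ z, ∀ j, dist z (t j) ≤ η * h → ‖P.eval z‖ ≤ 8 * η * M := by
    intro z j hz
    have hsub : ∀ y ∈ ball (t j) (h / 2), ‖P.eval y‖ ≤ M := by
      intro y hy
      refine hmax y ?_
      rw [mem_closedBall]
      have := dist_triangle y (t j) z₀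
      have := ht2 j
      rw [mem_ball] at hy
      linarith
    have := (dist_eval_le_of_forall_ball hsub (z := z) (by
      rw [mem_ball]; nlinarith)).1
    have h3 : 2 * M / (h / 2) * dist z (t j) ≤ 4 * η * M := by
      calc 2 * M / (h / 2) * dist z (t j) ≤ 2 * M / (h / 2) * (η * h) := by gcongr
        _ = 4 * η * M := by field_simp; ring
    linarith [hPt j]
  have hη1 : 8 * η < 1 := by
    have : (1:ℝ) / (8 * s) ≤ 1 / 8 := one_div_le_one_div_of_le (by norm_num) (by linarith)
    rcases hη8.lt_or_eq with h | h
    · linarith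
    · exfalso
      rw [h] at hηdef
      have h3 : (1:ℝ) ≤ 4 ^ s := one_le_pow₀ (by norm_num)
      have h4 : (1:ℝ) ≤ (8 * s) ^ (2 * s) := one_le_pow₀ (by linarith)
      nlinarith [mul_le_mul h3 h4 (by positivity) (by positivity)]
  have hζr : ∀ j, η * h < dist ζ (t j) := by
    intro j
    by_contra hle
    have := hnear ζ j (not_lt.1 hle)
    rw [← hM] at this
    nlinarith
  set B₁ : ℝ := ((4 / η) ^ s * A) ^ N with hB₁
  set B₂ : ℝ := (8 * η * M) ^ N * ((4 * N) ^ s) ^ N / η ^ s with hB₂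
  have hB₂0 : 0 < B₂ := by positivity
  have hH1 : ∀ z ∈ Γ, (∀ j, η * h ≤ dist z (t j)) →
      ‖P.eval z‖ ^ N ≤ B₁ * ∏ j, (dist z (t j) / h) ^ s := by
    intro z hz hzr
    set a := dist z z₀ / h with ha
    have ha0 : 0 ≤ a := by positivity
    have hj : ∀ j, η / 4 * (1 + a) ≤ dist z (t j) / h := by
      intro j
      rcases le_total a 1 with h1 | h1
      · have : η ≤ dist z (t j) / h := by rw [le_div_iff₀ hh]; exact hzr j
        nlinarith
      · have h3 := dist_triangle z (t j) z₀
        have h4 := ht2 j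
        have h5 : a - 1 / 2 ≤ dist z (t j) / h := by
          rw [le_div_iff₀ hh, sub_mul, ha, div_mul_cancel₀ _ hh.ne']
          linarith
        nlinarith
    calc ‖P.eval z‖ ^ N ≤ (A * (1 + a) ^ s) ^ N := by gcongr; exact hA z hz
      _ = B₁ * ∏ _j : Fin N, (η / 4 * (1 + a)) ^ s := by
        rw [Finset.prod_const, Finset.card_univ, Fintype.card_fin, hB₁, ← mul_pow]
        congr 1
        rw [mul_pow, div_pow, div_pow]
        field_simp
      _ ≤ _ := by
        gcongr with j
        exact hj j
  have hH2 : ∀ z, (∀ j, η * h ≤ dist z (t j)) → (∃ j, dist z (t j) = η * h) →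
      ‖P.eval z‖ ^ N ≤ B₂ * ∏ j, (dist z (t j) / h) ^ s := by
    rintro z - ⟨k, hk⟩
    have hj : ∀ j, j ≠ k → 1 / (4 * N) ≤ dist z (t j) / h := by
      intro j hjk
      have h1 := hsep j k hjk
      have h2 := dist_triangle (t j) z (t k)
      rw [hk, dist_comm (t j) z] at h2
      rw [le_div_iff₀ hh]
      have h3 : η * h ≤ 1 / (4 * N) * h := by gcongr
      have h4 : h / (2 * N) = 2 * (1 / (4 * N) * h) := by field_simp; ring
      linarith
    have hprod : η ^ s * ((1 / (4 * N)) ^ s) ^ N ≤ ∏ j, (dist z (t j) / h) ^ s := by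
      rw [← Finset.mul_prod_erase _ _ (Finset.mem_univ k), hk, mul_div_cancel_right₀ _ hh.ne']
      have h5 : (1 / (4 * N : ℝ)) ≤ 1 := by
        rw [div_le_one (by positivity)]
        linarith
      gcongr
      calc ((1 / (4 * N : ℝ)) ^ s) ^ N ≤ ((1 / (4 * N : ℝ)) ^ s) ^ (N - 1) :=
            pow_le_pow_of_le_one (by positivity) (pow_le_one₀ (by positivity) h5) (by omega)
        _ = ∏ _j ∈ Finset.univ.erase k, (1 / (4 * N : ℝ)) ^ s := by
          rw [Finset.prod_const, Finset.card_erase_of_mem (Finset.mem_univ k), Finset.card_univ,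
            Fintype.card_fin]
        _ ≤ _ := by
          exact Finset.prod_le_prod (fun _ _ => by positivity) fun j hjm =>
            pow_le_pow_left₀ (by positivity) (hj j (Finset.ne_of_mem_erase hjm)) s
    calc ‖P.eval z‖ ^ N ≤ (8 * η * M) ^ N := by gcongr; exact hnear z k hk.le
      _ = B₂ * (η ^ s * ((1 / (4 * N)) ^ s) ^ N) := by
        rw [hB₂, one_div, inv_pow, inv_pow]
        field_simp
      _ ≤ _ := by gcongr
  have hPnn : ∀ z, 0 ≤ ∏ j, (dist z (t j) / h) ^ s := fun z =>
    Finset.prod_nonneg fun j _ => by positivity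
  have hfin := norm_eval_pow_le_of_poles hU hUΓ hΨ hΨ1 hK (N := N) (s := s) (by omega) hs t
    (r := η * h) (B := max B₁ B₂) hh (by positivity) (lt_max_of_lt_right hB₂0)
    (fun z hz hzr => (hH1 z hz hzr).trans
      (mul_le_mul_of_nonneg_right (le_max_left _ _) (hPnn z)))
    (fun z hz hzr => (hH2 z hz hzr).trans
      (mul_le_mul_of_nonneg_right (le_max_right _ _) (hPnn z))) hζU hζr
  have hprod2 : ∏ j, (dist ζ (t j) / h) ^ s ≤ (2 ^ s) ^ N := by
    calc ∏ j, (dist ζ (t j) / h) ^ s ≤ ∏ _j : Fin N, (2:ℝ) ^ s := by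
          gcongr with j
          rw [div_le_iff₀ hh]
          have h1 := dist_triangle ζ z₀ (t j)
          have h2 := ht2 j
          rw [dist_comm z₀] at h1
          rw [mem_closedBall] at hζ
          linarith
      _ = _ := by simp
  have hfin2 : M ^ N ≤ max B₁ B₂ * (2 ^ s) ^ N * 3 ^ N := by
    refine hfin.trans ?_
    have : 0 ≤ max B₁ B₂ := hB₂0.le.trans (le_max_right _ _)
    gcongr
  rcases le_total B₁ B₂ with h12 | h12
  · rw [max_eq_right h12, hB₂] at hfin2
    rw [hN, mul_pow_two_mul_eq hη, ← hN] at hfin2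
    have h43 : (4 * (N:ℝ)) = 8 * s := by rw [hN]; push_cast; ring
    rw [h43, hN, hηdef, ← hN] at hfin2
    have h3 : ((1:ℝ) / 2) ^ s ≤ 1 / 2 := pow_le_of_le_one (by norm_num) (by norm_num) (by omega)
    have h4 : 0 < M ^ N := by positivity
    nlinarith
  · rw [max_eq_left h12, hB₁, ← mul_pow, ← mul_pow] at hfin2
    have h5 := (pow_le_pow_iff_left₀ hM0.le (by positivity) (by omega)).1 hfin2
    have h6 : (4 / η) ^ s * A * 2 ^ s * 3 = 3 * (8 / η) ^ s * A := by
      have : (8 / η) ^ s = (4 / η) ^ s * 2 ^ s := by rw [← mul_pow]; ring_nf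
      rw [this]; ring
    rw [h6] at h5
    have h7 : 0 ≤ (8 / η) ^ s * A := by positivity
    linarith

theorem IsExtConformal.exists_norm_eval_le {Γ : Set ℂ} {Φ : ℂ → ℂ}
    (hΦ : IsExtConformal (unboundedComponent Γ) Φ) {n : ℕ} {P : Polynomial ℂ}
    (hP : P.natDegree ≤ n) :
    ∃ K, ∀ᶠ z in Bornology.cobounded ℂ, ‖P.eval z‖ ≤ K * ‖Φ z‖ ^ n := by
  obtain ⟨-, -, c, hc, hlim⟩ := hΦ
  obtain ⟨K, hK0, hK⟩ := exists_norm_eval_le_mul_pow hP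
  have h1 := hlim.norm
  rw [Complex.norm_real, Real.norm_of_nonneg hc.le] at h1
  have h2 : ∀ᶠ z in Bornology.cobounded ℂ, c / 2 < ‖Φ z / z‖ :=
    h1.eventually (lt_mem_nhds (by linarith))
  have h3 : ∀ᶠ z : ℂ in Bornology.cobounded ℂ, 1 ≤ ‖z‖ :=
    (tendsto_norm_cobounded_atTop (E := ℂ)).eventually (eventually_ge_atTop 1)
  refine ⟨K * (2 / c) ^ n, ?_⟩
  filter_upwards [h2, h3] with z hz hz1
  refine (hK z hz1).trans ?_
  rw [mul_assoc, ← mul_pow]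
  gcongr
  rw [norm_div, lt_div_iff₀ (by linarith)] at hz
  rw [div_mul_eq_mul_div, le_div_iff₀ hc]
  linarith

/-- A local Bernstein–Walsh inequality: growth of order `s` of a polynomial along `Γ` away from
`z₀` controls the polynomial in a full neighbourhood of `z₀`. -/
theorem IsExtConformal.norm_eval_le_of_dist_le {s : ℕ} (hs : 1 ≤ s) {Γ : Set ℂ}
    (hΓ : IsCompact Γ) (hΓc : IsPreconnected Γ) {Φ : ℂ → ℂ}
    (hΦ : IsExtConformal (unboundedComponent Γ) Φ) {n : ℕ} (hn : 1 ≤ n) {P : Polynomial ℂ}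
    (hP : P.natDegree ≤ n) {z₀ : ℂ} (hz₀ : z₀ ∈ Γ) {h : ℝ} (hh : 0 < h)
    (hhd : h < setDist Γ (levelCurve (unboundedComponent Γ) Φ (1 / (n:ℝ))))
    (hfar : ∃ z' ∈ Γ, h / 2 ≤ dist z' z₀) {A : ℝ}
    (hA : ∀ z ∈ Γ, ‖P.eval z‖ ≤ A * (1 + dist z z₀ / h) ^ s) {ζ : ℂ}
    (hζ : ζ ∈ closedBall z₀ h) :
    ‖P.eval ζ‖ ≤ 6 * (8 / poleRadius s) ^ s * A := by
  have hA0 : 0 ≤ A := by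
    have := hA z₀ hz₀
    rw [dist_self, zero_div, add_zero, one_pow, mul_one] at this
    exact (norm_nonneg _).trans this
  obtain ⟨ξ, hξ, hmax⟩ := (isCompact_closedBall z₀ h).exists_isMaxOn ⟨ζ, hζ⟩
    (f := fun z => ‖P.eval z‖) (by fun_prop)
  replace hmax : ∀ z ∈ closedBall z₀ h, ‖P.eval z‖ ≤ ‖P.eval ξ‖ := fun z hz => hmax hz
  refine (hmax ζ hζ).trans ?_
  by_cases hξΓ : ξ ∈ Γ
  · refine (hA ξ hξΓ).trans ?_
    have hr := poleRadius_pos hs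
    have hr1 : poleRadius s ≤ 1 := (poleRadius_le hs).trans (by
      rw [div_le_one (by positivity)]
      have : (1:ℝ) ≤ s := by exact_mod_cast hs
      linarith)
    have h2 : 1 + dist ξ z₀ / h ≤ 8 / poleRadius s := by
      have h3 : dist ξ z₀ / h ≤ 1 := by rw [div_le_one hh]; exact hξ
      have h4 : 8 ≤ 8 / poleRadius s := by
        rw [le_div_iff₀ hr]
        linarith
      linarith
    have h5 : (1 + dist ξ z₀ / h) ^ s ≤ (8 / poleRadius s) ^ s := by gcongr
    have h6 : 0 ≤ (8 / poleRadius s) ^ s := by positivity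
    rw [mul_comm]
    gcongr
    linarith
  · by_cases hξΩ : ξ ∈ unboundedComponent Γ
    · obtain ⟨K, hK⟩ := hΦ.exists_norm_eval_le hP
      have hn0 : (0:ℝ) < n := by exact_mod_cast hn
      have hle := hΦ.norm_le_of_dist_lt hΓ (δ := 1 / (n:ℝ)) (by positivity) hξΩ hz₀
        (lt_of_le_of_lt hξ hhd)
      refine norm_eval_le_of_isMax hs hΓc (isOpen_unboundedComponent hΓ)
        (frontier_unboundedComponent_subset hΓ) hΦ.1 (fun z hz => (hΦ.2.1.1 hz).le)
        (hK.mono fun z hz _ => hz) hz₀ hh hfar hA hξ hmax hξΩ ?_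
      calc ‖Φ ξ‖ ^ n ≤ (1 + 1 / (n:ℝ)) ^ n := by gcongr
        _ ≤ (Real.exp (1 / (n:ℝ))) ^ n := by
          gcongr
          rw [add_comm]
          exact Real.add_one_le_exp _
        _ = Real.exp 1 := by
          rw [← Real.exp_nat_mul, mul_one_div_cancel hn0.ne']
        _ ≤ 3 := by linarith [Real.exp_one_lt_d9]
    · have hb : Bornology.IsBounded (connectedComponentIn Γᶜ ξ) := by
        by_contra hb
        exact hξΩ (show _ ∧ _ from ⟨hξΓ, hb⟩)
      refine norm_eval_le_of_isMax (Ψ := fun _ => 1) (n := n) (K := 0) hs hΓc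
        hΓ.isClosed.isOpen_compl.connectedComponentIn
        (frontier_connectedComponentIn_subset hΓ ξ) (differentiableOn_const 1) (by simp)
        ?_ hz₀ hh hfar hA hξ hmax (mem_connectedComponentIn hξΓ) (by simp)
      have := Bornology.isBounded_def.1 hb
      filter_upwards [this] with z hz hz'
      exact absurd hz' hz

end LocalBernsteinWalsh

section PeriodicParametrization

/-- `g` is a continuous `T`-periodic map, injective on a period, with image `Γ`. -/
structure IsPeriodicParam (Γ : Set ℂ) (T : ℝ) (g : ℝ → ℂ) : Prop where
  pos : 0 < T
  continuous : Continuous g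
  periodic : ∀ t, g (t + T) = g t
  injective : ∀ a b, a ≤ b → b < a + T → g a = g b → a = b
  range_eq : range g = Γ

theorem IsJordanCurve.exists_isPeriodicParam {Γ : Set ℂ} (hΓ : IsJordanCurve Γ) :
    ∃ g, IsPeriodicParam Γ (2 * Real.pi) g := by
  obtain ⟨γ, hc, hi, rfl⟩ := hΓ
  have hmem : ∀ t : ℝ, Complex.exp (t * I) ∈ Metric.sphere (0:ℂ) 1 := fun t => by
    simp [Complex.norm_exp_ofReal_mul_I]
  refine ⟨fun t => γ (Complex.exp (t * I)), by positivity, ?_, ?_, ?_, ?_⟩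
  · exact hc.comp_continuous (by fun_prop) hmem
  · intro t
    congr 1
    push_cast
    rw [add_mul, Complex.exp_periodic]
  · intro a b hab hb h
    have h1 := hi (hmem a) (hmem b) h
    rw [Complex.exp_eq_exp_iff_exists_int] at h1
    obtain ⟨n, hn⟩ := h1
    have h2 : (a : ℂ) = b + n * (2 * Real.pi) := by
      have : (a:ℂ) * I = (b + n * (2 * Real.pi)) * I := by rw [hn]; ring
      exact mul_right_cancel₀ I_ne_zero this
    have h3 : a = b + n * (2 * Real.pi) := by exact_mod_cast h2
    have hpi := Real.pi_pos
    have h4 : -1 < (n:ℝ) := by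
      by_contra hle
      push Not at hle
      nlinarith
    have h5 : (n:ℝ) ≤ 0 := by
      by_contra hle
      push Not at hle
      nlinarith
    have h6 : n = 0 := by
      have : -1 < n := by exact_mod_cast h4
      have : n ≤ 0 := by exact_mod_cast h5
      omega
    rw [h6] at h3
    simpa using h3
  · ext z
    constructor
    · rintro ⟨t, rfl⟩
      exact ⟨_, hmem t, rfl⟩
    · rintro ⟨u, hu, rfl⟩
      refine ⟨Complex.arg u, ?_⟩
      have := Complex.norm_mul_exp_arg_mul_I u
      rw [mem_sphere_zero_iff_norm.1 hu] at this
      rw [ofReal_one, one_mul] at this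
      exact congrArg γ this

/-- A connected set has length at least the distance between any two of its points. -/
theorem IsPreconnected.ofReal_dist_le_hausdorffMeasure {K : Set ℂ} (hK : IsPreconnected K)
    {x y : ℂ} (hx : x ∈ K) (hy : y ∈ K) : ENNReal.ofReal (dist x y) ≤ μH[1] K := by
  have hlip : LipschitzOnWith 1 (fun z : ℂ => dist z x) K :=
    (LipschitzWith.dist_left x).lipschitzOnWith
  have h1 := hlip.hausdorffMeasure_image_le (d := 1) zero_le_one
  have h2 : Icc 0 (dist x y) ⊆ (fun z => dist z x) '' K := by
    have := hK.intermediate_value hx hy (f := fun z => dist z x) (by fun_prop)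
    rwa [dist_self, dist_comm] at this
  have h3 := (measure_mono h2).trans h1
  rw [hausdorffMeasure_real, Real.volume_Icc, sub_zero] at h3
  simpa using h3

namespace IsPeriodicParam

variable {Γ : Set ℂ} {T : ℝ} {g : ℝ → ℂ}

theorem apply_mem (hg : IsPeriodicParam Γ T g) (t : ℝ) : g t ∈ Γ :=
  hg.range_eq ▸ mem_range_self t

theorem image_Icc_add (hg : IsPeriodicParam Γ T g) (a b : ℝ) :
    g '' Icc (a + T) (b + T) = g '' Icc a b := by
  rw [← image_add_const_Icc, image_image]
  simp only [hg.periodic]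

theorem exists_mem_Ico (hg : IsPeriodicParam Γ T g) (a : ℝ) {z : ℂ} (hz : z ∈ Γ) :
    ∃ t ∈ Ico a (a + T), g t = z := by
  rw [← hg.range_eq] at hz
  obtain ⟨t, rfl⟩ := hz
  have hp : Function.Periodic g T := hg.periodic
  obtain ⟨y, hy, h⟩ := hp.exists_mem_Ico hg.pos t a
  exact ⟨y, hy, h.symm⟩

theorem image_Icc_inter (hg : IsPeriodicParam Γ T g) {a b c : ℝ} (hc : c ≤ a + T) :
    g '' Icc a b ∩ g '' Icc b c ⊆ {g a, g b} := by
  rintro _ ⟨⟨s, hs, rfl⟩, ⟨t, ht, hts⟩⟩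
  rcases eq_or_lt_of_le (ht.2.trans hc) with h | h
  · left
    rw [← hts, h, hg.periodic]
  · right
    have := hg.injective s t (hs.2.trans ht.1) (h.trans_le (by linarith [hs.1])) hts.symm
    have : s = b := le_antisymm hs.2 (this ▸ ht.1)
    rw [this]
    rfl

theorem image_Icc_union {a b c : ℝ} (hab : a ≤ b) (hbc : b ≤ c) :
    g '' Icc a b ∪ g '' Icc b c = g '' Icc a c := by
  rw [← image_union, Icc_union_Icc_eq_Icc hab hbc]

theorem subset_of_isPreconnected (hg : IsPeriodicParam Γ T g) {J : Set ℂ} (hJΓ : J ⊆ Γ)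
    (hJ : IsPreconnected J) {a b : ℝ}
    (ha : g a ∈ J) (hgb : g b ∈ J) : g '' Icc a b ⊆ J ∨ g '' Icc b (a + T) ⊆ J := by
  by_contra hcon
  push Not at hcon
  obtain ⟨h1, h2⟩ := hcon
  obtain ⟨_, ⟨c, hc, rfl⟩, hcJ⟩ := not_subset.1 h1
  obtain ⟨_, ⟨e, he, rfl⟩, heJ⟩ := not_subset.1 h2
  have hcl : ∀ x y, IsClosed (g '' Icc x y) := fun x y =>
    (isCompact_Icc.image hg.continuous).isClosed
  obtain ⟨x, hxJ, hx⟩ := isPreconnected_closed_iff.1 hJ (g '' Icc c e) (g '' Icc e (c + T))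
    (hcl _ _) (hcl _ _) (by
      rw [image_Icc_union (hc.2.trans he.1) (by linarith [he.2, hc.1, hc.2])]
      intro z hz
      obtain ⟨t, ht, rfl⟩ := hg.exists_mem_Ico c (hJΓ hz)
      exact ⟨t, Ico_subset_Icc_self ht, rfl⟩)
    ⟨g b, hgb, b, ⟨hc.2, he.1⟩, rfl⟩
    ⟨g a, ha, a + T, ⟨he.2, by linarith [hc.1]⟩, hg.periodic a⟩
  rcases hg.image_Icc_inter le_rfl hx with h | h
  · exact hcJ (h ▸ hxJ)
  · exact heJ (mem_singleton_iff.1 h ▸ hxJ)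

theorem min_length_le (hg : IsPeriodicParam Γ T g) {Λ : ℝ} (hΛ : IsQuasismooth Γ Λ) (a b : ℝ) :
    min (μH[1] (g '' Icc a b)) (μH[1] (g '' Icc b (a + T))) ≤
      ENNReal.ofReal (Λ * dist (g a) (g b)) := by
  refine le_trans ?_ (hΛ.2 _ (hg.apply_mem a) _ (hg.apply_mem b))
  refine le_iInf₂ fun J hJ => ?_
  rcases hg.subset_of_isPreconnected hJ.1.1 hJ.1.2.2 hJ.2.1 hJ.2.2 with h | h
  · exact (min_le_left _ _).trans (measure_mono h)
  · exact (min_le_right _ _).trans (measure_mono h)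

theorem ofReal_dist_le (hg : IsPeriodicParam Γ T g) {a b x y : ℝ} (hx : x ∈ Icc a b)
    (hy : y ∈ Icc a b) : ENNReal.ofReal (dist (g x) (g y)) ≤ μH[1] (g '' Icc a b) :=
  (isPreconnected_Icc.image g hg.continuous.continuousOn).ofReal_dist_le_hausdorffMeasure
    (mem_image_of_mem g hx) (mem_image_of_mem g hy)

theorem length_add (hg : IsPeriodicParam Γ T g) {a b c : ℝ} (hab : a ≤ b)
    (hbc : b ≤ c) (hc : c ≤ a + T) :
    μH[1] (g '' Icc a c) = μH[1] (g '' Icc a b) + μH[1] (g '' Icc b c) := by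
  rw [← image_Icc_union hab hbc]
  have : NullSingletonClass (μH[1] : Measure ℂ) :=
    Measure.nullSingletonClass_hausdorff ℂ one_pos
  refine measure_union₀ ?_ ?_
  · exact (isCompact_Icc.image hg.continuous).isClosed.measurableSet.nullMeasurableSet
  · refine measure_mono_null (hg.image_Icc_inter hc) ?_
    exact (toFinite _).countable.measure_zero _

theorem exists_length_le (hg : IsPeriodicParam Γ T g) {Λ : ℝ} (hΛ : IsQuasismooth Γ Λ) :
    ∃ τ > 0, ∀ a b, a ≤ b → b ≤ a + τ →
      μH[1] (g '' Icc a b) ≤ ENNReal.ofReal (Λ * dist (g a) (g b)) := by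
  have hT := hg.pos
  set D := dist (g 0) (g (T / 2)) with hD
  have hD0 : 0 < D := dist_pos.2 fun h => by
    have := hg.injective 0 (T / 2) (by linarith) (by linarith) h
    linarith
  have hΛ1 := hΛ.1
  obtain ⟨τ, hτ, hu⟩ : ∃ τ > 0, ∀ a b : ℝ, dist a b < τ → dist (g a) (g b) < D / (2 * Λ) := by
    have hp : Function.Periodic g T := hg.periodic
    have hcu : UniformContinuousOn g (Icc 0 (2 * T)) :=
      isCompact_Icc.uniformContinuousOn_of_continuous hg.continuous.continuousOn
    obtain ⟨τ, hτ, h⟩ := Metric.uniformContinuousOn_iff.1 hcu (D / (2 * Λ)) (by positivity)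
    refine ⟨min τ T, by positivity, ?_⟩
    have key : ∀ a b : ℝ, a ≤ b → dist a b < min τ T → dist (g a) (g b) < D / (2 * Λ) := by
      intro a b hab hd
      obtain ⟨hd1, hd2⟩ := lt_min_iff.1 hd
      rw [Real.dist_eq, abs_sub_comm, abs_of_nonneg (by linarith)] at hd2
      have h1 : ∀ x, g (x - toIcoDiv hT 0 a • T) = g x := fun x => hp.sub_zsmul_eq _
      have h2 := toIcoMod_mem_Ico hT 0 a
      rw [toIcoMod] at h2
      rw [← h1 a, ← h1 b]
      refine h _ ⟨h2.1, by linarith [h2.2]⟩ _ ⟨by linarith [h2.1], by linarith [h2.2]⟩ ?_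
      rwa [dist_sub_right]
    intro a b hd
    rcases le_total a b with hab | hab
    · exact key a b hab hd
    · rw [dist_comm]
      exact key b a hab (by rwa [dist_comm])
  refine ⟨min (τ / 2) T, by positivity, fun a b hab hb => ?_⟩
  have hb1 : b ≤ a + τ / 2 := hb.trans (by gcongr; exact min_le_left _ _)
  have hb2 : b ≤ a + T := hb.trans (by gcongr; exact min_le_right _ _)
  have hsmall : ∀ x ∈ Icc a b, dist (g x) (g a) < D / (2 * Λ) := fun x hx => by
    refine hu x a ?_
    rw [Real.dist_eq, abs_of_nonneg (by linarith [hx.1])]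
    linarith [hx.2]
  have hDΛ : D / (2 * Λ) ≤ D / 2 := by gcongr; linarith
  rcases min_le_iff.1 (hg.min_length_le hΛ _ _) with h | h
  · exact h
  · exfalso
    have hdist : ∀ x, dist (g x) (g a) < D / 2 := by
      intro x
      obtain ⟨t, ht, htx⟩ := hg.exists_mem_Ico a (hg.apply_mem x)
      rw [← htx]
      rcases le_total t b with htb | htb
      · exact (hsmall t ⟨ht.1, htb⟩).trans_le hDΛ
      · have h1 := (hg.ofReal_dist_le (a := b) (b := a + T) (x := t) (y := a + T)
          ⟨htb, ht.2.le⟩ ⟨hb2, le_rfl⟩).trans h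
        rw [ENNReal.ofReal_le_ofReal_iff (by positivity), hg.periodic] at h1
        refine h1.trans_lt ?_
        have h2 := hsmall b ⟨hab, le_rfl⟩
        rw [dist_comm, lt_div_iff₀ (by positivity)] at h2
        linarith
    have h0 := hdist 0
    have h1 := hdist (T / 2)
    have h2 := dist_triangle_right (g 0) (g (T / 2)) (g a)
    linarith

theorem length_ne_top (hg : IsPeriodicParam Γ T g) {Λ : ℝ} (hΛ : IsQuasismooth Γ Λ) (a b : ℝ) :
    μH[1] (g '' Icc a b) ≠ ∞ := by
  obtain ⟨τ, hτ, h⟩ := hg.exists_length_le hΛ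
  have key : ∀ (k : ℕ) (b : ℝ), b ≤ a + k * τ → μH[1] (g '' Icc a b) ≠ ∞ := by
    intro k
    induction k with
    | zero =>
      intro b hb
      rcases hb.lt_or_eq with hb | hb
      · rw [Icc_eq_empty (by simpa using hb)]
        simp
      · exact ((h a b (by simp [hb]) (by simp at hb; linarith)).trans_lt ENNReal.ofReal_lt_top).ne
    | succ k ih =>
      intro b hb
      push_cast at hb
      rcases le_total b (a + τ) with hb1 | hb1
      · rcases lt_or_ge b a with hba | hba
        · rw [Icc_eq_empty (not_le.2 hba)]
          simp
        · exact ((h a b hba hb1).trans_lt ENNReal.ofReal_lt_top).ne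
      · rw [← image_Icc_union (b := b - τ) (by linarith) (by linarith)]
        refine ((measure_union_le _ _).trans_lt (ENNReal.add_lt_top.2 ⟨?_, ?_⟩)).ne
        · exact (ih _ (by linarith)).lt_top
        · exact (h (b - τ) b (by linarith) (by linarith)).trans_lt ENNReal.ofReal_lt_top
  obtain ⟨k, hk⟩ := exists_nat_ge ((b - a) / τ)
  refine key k b ?_
  rw [div_le_iff₀ hτ] at hk
  linarith

end IsPeriodicParam

end PeriodicParametrization

section Arclength

/-- `σ` is a parametrization of `Γ` by arclength with period `L`, and the shorter of the two arcs
between two points is at most `Λ` times their distance. -/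
structure IsArclengthParam (Γ : Set ℂ) (Λ L : ℝ) (σ : ℝ → ℂ) : Prop extends
    IsPeriodicParam Γ L σ where
  length_eq : ∀ a b, a ≤ b → b ≤ a + L → μH[1] (σ '' Icc a b) = ENNReal.ofReal (b - a)
  min_le : ∀ a b, a ≤ b → b ≤ a + L → min (b - a) (L - (b - a)) ≤ Λ * dist (σ a) (σ b)

variable {Γ : Set ℂ} {T Λ : ℝ} {g : ℝ → ℂ}

/-- The arclength coordinate of a periodic parametrization, measured from the parameter `0`. -/
def arclengthCoord (T : ℝ) (g : ℝ → ℂ) (t : ℝ) : ℝ :=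
  (μH[1] (g '' Icc 0 T)).toReal * ⌊t / T⌋ + (μH[1] (g '' Icc 0 (t - T * ⌊t / T⌋))).toReal

namespace IsPeriodicParam

theorem toReal_length_add (hg : IsPeriodicParam Γ T g) (hΛ : IsQuasismooth Γ Λ) {a b c : ℝ}
    (hab : a ≤ b) (hbc : b ≤ c) (hc : c ≤ a + T) :
    (μH[1] (g '' Icc a c)).toReal =
      (μH[1] (g '' Icc a b)).toReal + (μH[1] (g '' Icc b c)).toReal := by
  rw [hg.length_add hab hbc hc, ENNReal.toReal_add (hg.length_ne_top hΛ _ _)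
    (hg.length_ne_top hΛ _ _)]

theorem arclengthCoord_add (hg : IsPeriodicParam Γ T g) (t : ℝ) :
    arclengthCoord T g (t + T) = arclengthCoord T g t + (μH[1] (g '' Icc 0 T)).toReal := by
  have hT := hg.pos.ne'
  have h1 : ⌊(t + T) / T⌋ = ⌊t / T⌋ + 1 := by
    rw [add_div, div_self hT, Int.floor_add_one]
  unfold arclengthCoord
  rw [h1]
  push_cast
  have h2 : t + T - T * (⌊t / T⌋ + 1) = t - T * ⌊t / T⌋ := by ring
  rw [h2]
  ring

theorem arclengthCoord_of_mem (hg : IsPeriodicParam Γ T g) {t : ℝ} (ht : t ∈ Ico 0 T) :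
    arclengthCoord T g t = (μH[1] (g '' Icc 0 t)).toReal := by
  have h1 : ⌊t / T⌋ = 0 := by
    rw [Int.floor_eq_zero_iff]
    exact ⟨div_nonneg ht.1 hg.pos.le, (div_lt_one hg.pos).2 ht.2⟩
  simp [arclengthCoord, h1]

theorem arclengthCoord_sub (hg : IsPeriodicParam Γ T g) (hΛ : IsQuasismooth Γ Λ) {a b : ℝ}
    (hab : a ≤ b) (hb : b ≤ a + T) :
    arclengthCoord T g b - arclengthCoord T g a = (μH[1] (g '' Icc a b)).toReal := by
  have hT := hg.pos
  have key : ∀ a b, a ∈ Ico 0 T → a ≤ b → b ≤ a + T →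
      arclengthCoord T g b - arclengthCoord T g a = (μH[1] (g '' Icc a b)).toReal := by
    intro a b ha hab hb
    rw [hg.arclengthCoord_of_mem ha]
    rcases lt_or_ge b T with hbT | hbT
    · rw [hg.arclengthCoord_of_mem ⟨ha.1.trans hab, hbT⟩,
        hg.toReal_length_add hΛ ha.1 hab (by linarith)]
      ring
    · have h1 := hg.arclengthCoord_add (b - T)
      rw [sub_add_cancel] at h1
      rw [h1, hg.arclengthCoord_of_mem ⟨by linarith, by linarith [ha.2]⟩,
        hg.toReal_length_add hΛ ha.1 ha.2.le (by linarith),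
        hg.toReal_length_add hΛ ha.2.le hbT hb]
      have h2 := hg.image_Icc_add 0 (b - T)
      rw [sub_add_cancel, zero_add] at h2
      rw [h2]
      ring
  have hshift : ∀ (k : ℤ) (t : ℝ), arclengthCoord T g (t + k * T) =
      arclengthCoord T g t + k * (μH[1] (g '' Icc 0 T)).toReal := by
    intro k t
    induction k with
    | zero => simp
    | succ i ih =>
      push_cast at ih ⊢
      rw [add_mul, one_mul, ← add_assoc, hg.arclengthCoord_add, ih]
      ring
    | pred i ih =>
      have h1 := hg.arclengthCoord_add (t + ((-(i:ℤ) - 1 : ℤ) : ℝ) * T)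
      push_cast at ih h1 ⊢
      have h2 : t + (-(i:ℝ) - 1) * T + T = t + -(i:ℝ) * T := by ring
      rw [h2, ih] at h1
      linarith
  have himg : ∀ (k : ℤ) (a b : ℝ), g '' Icc (a + k * T) (b + k * T) = g '' Icc a b := by
    intro k a b
    have hp : Function.Periodic g T := hg.periodic
    rw [← image_add_const_Icc, image_image]
    congr 1
    funext x
    exact hp.int_mul k x
  set k := ⌊a / T⌋ with hk
  have h1 := hshift k (a - k * T)
  have h2 := hshift k (b - k * T)
  have h3 := himg k (a - k * T) (b - k * T)
  rw [sub_add_cancel] at h1 h2 h3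
  rw [sub_add_cancel] at h3
  have h4 := Int.floor_le (a / T)
  have h5 := Int.lt_floor_add_one (a / T)
  rw [le_div_iff₀ hT] at h4
  rw [div_lt_iff₀ hT] at h5
  rw [h1, h2, h3, ← key (a - k * T) (b - k * T) ⟨by linarith, by linarith⟩ (by linarith)
    (by linarith)]
  ring

theorem strictMono_arclengthCoord (hg : IsPeriodicParam Γ T g) (hΛ : IsQuasismooth Γ Λ) :
    StrictMono (arclengthCoord T g) := by
  have hT := hg.pos
  have h1 : ∀ a b, a < b → b ≤ a + T / 2 → arclengthCoord T g a < arclengthCoord T g b := by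
    intro a b hab hb
    have h2 := hg.arclengthCoord_sub hΛ hab.le (by linarith)
    have h3 : 0 < dist (g a) (g b) := dist_pos.2 fun h =>
      hab.ne (hg.injective a b hab.le (by linarith) h)
    have h4 := hg.ofReal_dist_le (left_mem_Icc.2 hab.le) (right_mem_Icc.2 hab.le)
    have h5 : 0 < (μH[1] (g '' Icc a b)).toReal :=
      ENNReal.toReal_pos ((ENNReal.ofReal_pos.2 h3).trans_le h4).ne' (hg.length_ne_top hΛ _ _)
    linarith
  have h2 : ∀ (k : ℕ) (a b : ℝ), a < b → b ≤ a + k * (T / 2) →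
      arclengthCoord T g a < arclengthCoord T g b := by
    intro k
    induction k with
    | zero =>
      intro a b hab hb
      simp at hb
      linarith
    | succ k ih =>
      intro a b hab hb
      push_cast at hb
      rcases le_or_gt b (a + T / 2) with h | h
      · exact h1 a b hab h
      · exact (h1 a (a + T / 2) (by linarith) le_rfl).trans (ih _ b h (by linarith))
  intro a b hab
  obtain ⟨k, hk⟩ := exists_nat_ge ((b - a) / (T / 2))
  rw [div_le_iff₀ (by linarith)] at hk
  exact h2 k a b hab (by linarith)

theorem continuous_arclengthCoord (hg : IsPeriodicParam Γ T g) (hΛ : IsQuasismooth Γ Λ) :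
    Continuous (arclengthCoord T g) := by
  obtain ⟨τ, hτ, h⟩ := hg.exists_length_le hΛ
  have hT := hg.pos
  have hΛ1 := hΛ.1
  rw [continuous_iff_continuousAt]
  intro x
  have h1 : ∀ᶠ y in 𝓝 x, dist (arclengthCoord T g y) (arclengthCoord T g x) ≤
      Λ * dist (g y) (g x) := by
    filter_upwards [Metric.ball_mem_nhds x (show 0 < min τ T by positivity)] with y hy
    rw [mem_ball, Real.dist_eq] at hy
    obtain ⟨hy1, hy2⟩ := lt_min_iff.1 hy
    have key : ∀ a b, a ≤ b → b ≤ a + τ → b ≤ a + T →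
        |arclengthCoord T g b - arclengthCoord T g a| ≤ Λ * dist (g a) (g b) := by
      intro a b hab h2 h3
      rw [hg.arclengthCoord_sub hΛ hab h3, abs_of_nonneg ENNReal.toReal_nonneg]
      exact ENNReal.toReal_le_of_le_ofReal (by positivity) (h a b hab h2)
    rw [Real.dist_eq]
    rcases le_total x y with hxy | hxy
    · rw [abs_of_nonneg (by linarith)] at hy1 hy2
      rw [dist_comm (g y)]
      exact key x y hxy (by linarith) (by linarith)
    · rw [abs_sub_comm, abs_of_nonneg (by linarith)] at hy1 hy2
      rw [abs_sub_comm]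
      exact key y x hxy (by linarith) (by linarith)
  refine tendsto_iff_dist_tendsto_zero.2 (squeeze_zero' (.of_forall fun _ => dist_nonneg) h1 ?_)
  have h2 : Tendsto (fun y => Λ * dist (g y) (g x)) (𝓝 x) (𝓝 (Λ * dist (g x) (g x))) :=
    ((hg.continuous.dist continuous_const).const_mul Λ).tendsto x
  simpa using h2

theorem surjective_arclengthCoord (hg : IsPeriodicParam Γ T g) (hΛ : IsQuasismooth Γ Λ) :
    Function.Surjective (arclengthCoord T g) := by
  have hT := hg.pos
  set L := (μH[1] (g '' Icc 0 T)).toReal with hL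
  have hL0 : 0 < L := by
    have h1 := hg.arclengthCoord_add 0
    have h2 := hg.strictMono_arclengthCoord hΛ (show (0:ℝ) < 0 + T by linarith)
    linarith
  have hnat : ∀ (k : ℕ) t, arclengthCoord T g (t + k * T) = arclengthCoord T g t + k * L := by
    intro k t
    induction k with
    | zero => simp
    | succ k ih =>
      push_cast
      rw [add_mul, one_mul, ← add_assoc, hg.arclengthCoord_add, ih]
      ring
  intro y
  obtain ⟨k, hk⟩ := exists_nat_ge (|y - arclengthCoord T g 0| / L)
  rw [div_le_iff₀ hL0] at hk
  obtain ⟨hk1, hk2⟩ := abs_le.1 hk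
  have h1 := hnat k 0
  have h2 := hnat k (-(k * T))
  rw [neg_add_cancel] at h2
  rw [zero_add] at h1
  exact mem_range_of_exists_le_of_exists_ge (hg.continuous_arclengthCoord hΛ)
    ⟨_, show arclengthCoord T g (-(k * T)) ≤ y by linarith⟩
    ⟨_, show y ≤ arclengthCoord T g (k * T) by linarith⟩

theorem exists_isArclengthParam (hg : IsPeriodicParam Γ T g) (hΛ : IsQuasismooth Γ Λ) :
    ∃ L σ, IsArclengthParam Γ Λ L σ := by
  have hT := hg.pos
  set L := (μH[1] (g '' Icc 0 T)).toReal with hL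
  have hmono := hg.strictMono_arclengthCoord hΛ
  have hL0 : 0 < L := by
    have h1 := hg.arclengthCoord_add 0
    have h2 := hmono (show (0:ℝ) < 0 + T by linarith)
    linarith
  let e := hmono.orderIsoOfSurjective _ (hg.surjective_arclengthCoord hΛ)
  have he : ∀ t, e t = arclengthCoord T g t := fun t => rfl
  have heT : ∀ t, e.symm (t + L) = e.symm t + T := by
    intro t
    rw [OrderIso.symm_apply_eq, he, hg.arclengthCoord_add, ← he, e.apply_symm_apply]
  have hle : ∀ a b, b ≤ a + L → e.symm b ≤ e.symm a + T := by
    intro a b hb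
    rw [← heT]
    exact e.symm.monotone hb
  have himg : ∀ a b, (g ∘ e.symm) '' Icc a b = g '' Icc (e.symm a) (e.symm b) := by
    intro a b
    rw [image_comp, OrderIso.image_Icc]
  have hlen : ∀ a b, a ≤ b → b ≤ a + L →
      μH[1] ((g ∘ e.symm) '' Icc a b) = ENNReal.ofReal (b - a) := by
    intro a b hab hb
    have h1 := hg.arclengthCoord_sub hΛ (e.symm.monotone hab) (hle a b hb)
    rw [← he, ← he, e.apply_symm_apply, e.apply_symm_apply] at h1
    rw [himg, h1, ENNReal.ofReal_toReal (hg.length_ne_top hΛ _ _)]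
  refine ⟨L, g ∘ e.symm, ⟨hL0, hg.continuous.comp e.symm.continuous, ?_, ?_, ?_⟩, hlen, ?_⟩
  · intro t
    rw [Function.comp_apply, Function.comp_apply, heT, hg.periodic]
  · intro a b hab hb h
    have := hg.injective _ _ (e.symm.monotone hab) (by rw [← heT]; exact e.symm.strictMono hb) h
    exact e.symm.injective this
  · rw [range_comp, e.symm.surjective.range_eq, image_univ, hg.range_eq]
  · intro a b hab hb
    have h1 := hg.min_length_le hΛ (e.symm a) (e.symm b)
    rw [← heT, ← himg, ← himg, hlen a b hab hb, hlen b (a + L) hb (by linarith),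
      ← ENNReal.ofReal_min, ENNReal.ofReal_le_ofReal_iff
        (mul_nonneg (zero_le_one.trans hΛ.1) dist_nonneg)] at h1
    have h2 : L - (b - a) = a + L - b := by ring
    rw [h2]
    exact h1

end IsPeriodicParam

theorem IsArclengthParam.dist_le {L : ℝ} {σ : ℝ → ℂ} (hσ : IsArclengthParam Γ Λ L σ) {a b : ℝ}
    (hab : a ≤ b) (hb : b ≤ a + L) : dist (σ a) (σ b) ≤ b - a := by
  have h1 := hσ.ofReal_dist_le (left_mem_Icc.2 hab) (right_mem_Icc.2 hab)
  rw [hσ.length_eq a b hab hb] at h1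
  exact (ENNReal.ofReal_le_ofReal_iff (by linarith)).1 h1

end Arclength

section AInfty

variable {Γ : Set ℂ} {Λ L lam : ℝ} {σ : ℝ → ℂ} {ν : Measure ℂ}

namespace IsPeriodicParam

theorem isSubarc (hσ : IsPeriodicParam Γ L σ) (a b : ℝ) : IsSubarc Γ (σ '' Icc a b) := by
  refine ⟨?_, (isCompact_Icc.image hσ.continuous).isClosed,
    isPreconnected_Icc.image σ hσ.continuous.continuousOn⟩
  rintro _ ⟨t, -, rfl⟩
  exact hσ.apply_mem t

theorem image_Icc_eq (hσ : IsPeriodicParam Γ L σ) {a b : ℝ} (hab : a + L ≤ b) :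
    σ '' Icc a b = Γ := by
  refine (hσ.isSubarc a b).1.antisymm fun z hz => ?_
  obtain ⟨t, ht, rfl⟩ := hσ.exists_mem_Ico a hz
  exact ⟨t, ⟨ht.1, ht.2.le.trans hab⟩, rfl⟩

theorem isCompact (hσ : IsPeriodicParam Γ L σ) : IsCompact Γ := by
  rw [← hσ.image_Icc_eq (a := 0) (b := L) (by simp)]
  exact isCompact_Icc.image hσ.continuous

theorem isPreconnected (hσ : IsPeriodicParam Γ L σ) : IsPreconnected Γ := by
  rw [← hσ.image_Icc_eq (a := 0) (b := L) (by simp)]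
  exact (hσ.isSubarc _ _).2.2

theorem measurableSet_image_Icc (hσ : IsPeriodicParam Γ L σ) (a b : ℝ) :
    MeasurableSet (σ '' Icc a b) := (hσ.isSubarc a b).2.1.measurableSet

end IsPeriodicParam

theorem IsArclengthParam.length_eq_min (hσ : IsArclengthParam Γ Λ L σ) {a b : ℝ} (hab : a ≤ b) :
    μH[1] (σ '' Icc a b) = ENNReal.ofReal (min (b - a) L) := by
  rcases le_total b (a + L) with h | h
  · rw [hσ.length_eq a b hab h, min_eq_left (by linarith)]
  · rw [hσ.image_Icc_eq h, min_eq_right (by linarith),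
      ← hσ.image_Icc_eq (le_refl (a + L)), hσ.length_eq _ _ (by linarith [hσ.pos]) le_rfl]
    simp

theorem IsArclengthParam.measure_image_Icc_two_mul_le (hσ : IsArclengthParam Γ Λ L σ)
    (hν : IsAInftyMeasure Γ ν lam) (t : ℝ) {r : ℝ} (hr : 0 ≤ r) :
    ν (σ '' Icc (t - 2 * r) (t + 2 * r)) ≤
      ENNReal.ofReal lam * ν (σ '' Icc (t - r) (t + r)) := by
  refine hν.2 _ _ (hσ.isSubarc _ _) (image_mono (Icc_subset_Icc (by linarith) (by linarith)))
    (hσ.measurableSet_image_Icc _ _) ?_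
  rw [hσ.length_eq_min (by linarith), hσ.length_eq_min (by linarith),
    ← ENNReal.ofReal_ofNat 2, ← ENNReal.ofReal_mul (by norm_num)]
  refine ENNReal.ofReal_le_ofReal ?_
  have := hσ.pos
  rcases le_total (t + r - (t - r)) L with h | h
  · rw [min_eq_left h]
    exact (min_le_left _ _).trans (by linarith)
  · rw [min_eq_right h]
    exact (min_le_right _ _).trans (by linarith)

theorem IsArclengthParam.measure_image_Icc_two_pow_mul_le (hσ : IsArclengthParam Γ Λ L σ)
    (hν : IsAInftyMeasure Γ ν lam) (t : ℝ) {r : ℝ} (hr : 0 ≤ r) (i : ℕ) :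
    ν (σ '' Icc (t - 2 ^ i * r) (t + 2 ^ i * r)) ≤
      ENNReal.ofReal lam ^ i * ν (σ '' Icc (t - r) (t + r)) := by
  induction i with
  | zero => simp
  | succ i ih =>
    have h1 := hσ.measure_image_Icc_two_mul_le hν t (r := 2 ^ i * r) (by positivity)
    rw [← mul_assoc, ← pow_succ'] at h1
    refine h1.trans ?_
    rw [pow_succ', mul_assoc]
    gcongr

/-- The density of an `A∞` measure is comparable to its mean on at least half of each arc. -/
theorem IsArclengthParam.le_lintegral_rpow (hσ : IsArclengthParam Γ Λ L σ) {w : ℂ → ℝ}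
    (hw : Measurable w)
    (hνw : ν = ((μH[1] : Measure ℂ).restrict Γ).withDensity (fun z => ENNReal.ofReal (w z)))
    (hν : IsAInftyMeasure Γ ν lam) [IsFiniteMeasure ν] {θ : ℝ} (hθ : 0 < θ) {a b : ℝ}
    (hab : a < b) (hb : b ≤ a + L) :
    ENNReal.ofReal ((b - a) / 2 *
        ((ν (σ '' Icc a b)).toReal / (2 * lam * (b - a))) ^ θ) ≤
      ∫⁻ z in σ '' Icc a b, ENNReal.ofReal (w z ^ θ) ∂μH[1] := by
  set J := σ '' Icc a b with hJ
  have hJm : MeasurableSet J := hσ.measurableSet_image_Icc _ _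
  have hlen : μH[1] J = ENNReal.ofReal (b - a) := hσ.length_eq a b hab.le hb
  have hlam : 0 < lam := zero_lt_one.trans_le hν.1
  set a₀ := (ν J).toReal / (2 * lam * (b - a)) with ha₀
  have hba : 0 < b - a := by linarith
  have ha₀0 : 0 ≤ a₀ := by positivity
  have hSm : MeasurableSet (J ∩ {z | w z < a₀}) :=
    hJm.inter (measurableSet_lt hw measurable_const)
  rcases le_or_gt (μH[1] J) (2 * μH[1] (J ∩ {z | w z < a₀})) with h | h
  · have h1 := hν.2 J _ (hσ.isSubarc a b) inter_subset_left hSm h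
    have h2 : ν (J ∩ {z | w z < a₀}) ≤ ENNReal.ofReal a₀ * ENNReal.ofReal (b - a) := by
      rw [hνw, withDensity_apply _ hSm, Measure.restrict_restrict hSm, ← hlen]
      calc ∫⁻ z in J ∩ {z | w z < a₀} ∩ Γ, ENNReal.ofReal (w z) ∂μH[1]
          ≤ ∫⁻ _ in J ∩ {z | w z < a₀} ∩ Γ, ENNReal.ofReal a₀ ∂μH[1] := by
            refine setLIntegral_mono measurable_const fun z hz => ?_
            exact ENNReal.ofReal_le_ofReal (le_of_lt hz.1.2)
        _ = ENNReal.ofReal a₀ * μH[1] (J ∩ {z | w z < a₀} ∩ Γ) := by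
            rw [setLIntegral_const]
        _ ≤ _ := by
            gcongr
            exact inter_subset_left.trans inter_subset_left
    have h3 : ν J ≤ ENNReal.ofReal (lam * (a₀ * (b - a))) := by
      rw [ENNReal.ofReal_mul hlam.le, ENNReal.ofReal_mul ha₀0]
      exact h1.trans (by gcongr)
    have h4 := ENNReal.toReal_le_of_le_ofReal (by positivity) h3
    have h5 : lam * (a₀ * (b - a)) = (ν J).toReal / 2 := by
      rw [ha₀]
      field_simp
    rw [h5] at h4
    have h6 : (ν J).toReal = 0 := le_antisymm (by linarith) ENNReal.toReal_nonneg
    have h7 : a₀ = 0 := by rw [ha₀, h6, zero_div]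
    rw [h7, Real.zero_rpow hθ.ne']
    simp
  · have h1 : ENNReal.ofReal ((b - a) / 2) ≤ μH[1] (J \ {z | w z < a₀}) := by
      by_contra hlt
      push Not at hlt
      have h2 : μH[1] J = μH[1] (J ∩ {z | w z < a₀}) + μH[1] (J \ {z | w z < a₀}) :=
        (measure_inter_add_sdiff J (measurableSet_lt hw measurable_const)).symm
      have h3 : μH[1] (J ∩ {z | w z < a₀}) < ENNReal.ofReal ((b - a) / 2) := by
        by_contra hge
        push Not at hge
        refine absurd h (not_lt.2 ?_)
        calc μH[1] J = 2 * ENNReal.ofReal ((b - a) / 2) := by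
              rw [hlen, ← ENNReal.ofReal_ofNat 2, ← ENNReal.ofReal_mul (by norm_num)]
              congr 1
              ring
          _ ≤ _ := by gcongr
      have h4 := ENNReal.add_lt_add h3 hlt
      rw [← h2, hlen, ← ENNReal.ofReal_add (by linarith) (by linarith), add_halves] at h4
      exact lt_irrefl _ h4
    calc ENNReal.ofReal ((b - a) / 2 * a₀ ^ θ)
        = ENNReal.ofReal (a₀ ^ θ) * ENNReal.ofReal ((b - a) / 2) := by
          rw [← ENNReal.ofReal_mul (by positivity), mul_comm]
      _ ≤ ENNReal.ofReal (a₀ ^ θ) * μH[1] (J \ {z | w z < a₀}) := by gcongr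
      _ = ∫⁻ _ in J \ {z | w z < a₀}, ENNReal.ofReal (a₀ ^ θ) ∂μH[1] := by
          rw [setLIntegral_const]
      _ ≤ ∫⁻ z in J \ {z | w z < a₀}, ENNReal.ofReal (w z ^ θ) ∂μH[1] := by
          refine setLIntegral_mono (by fun_prop) fun z hz => ?_
          have hz2 : a₀ ≤ w z := not_lt.1 hz.2
          exact ENNReal.ofReal_le_ofReal (by gcongr)
      _ ≤ _ := lintegral_mono_set sdiff_subset

end AInfty

section CyclicDistance

/-- The distance of `j` and `k` on a cycle of length `m`. -/
def cycDist (m j k : ℕ) : ℝ := min |(j:ℝ) - k| (m - |(j:ℝ) - k|)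

theorem cycDist_nonneg {m j k : ℕ} (hj : j < m) (hk : k < m) : 0 ≤ cycDist m j k := by
  have h1 : (j:ℝ) < m := by exact_mod_cast hj
  have h2 : (k:ℝ) < m := by exact_mod_cast hk
  have h3 : (0:ℝ) ≤ j := by positivity
  have h4 : (0:ℝ) ≤ k := by positivity
  refine le_min (abs_nonneg _) ?_
  rw [sub_nonneg, abs_le]
  constructor <;> linarith

theorem exists_sum_cycDist_le : ∃ S > 0, ∀ m k, k < m →
    ∑ j ∈ Finset.range m, ((1 + cycDist m j k) ^ 2)⁻¹ ≤ S := by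
  set f : ℤ → ℝ := fun i => ((1 + |(i:ℝ)|) ^ 2)⁻¹ with hf
  have hf0 : ∀ i, 0 < f i := fun i => by positivity
  have hsum : Summable f := by
    have h1 : Summable fun i : ℤ => 1 / (i:ℝ) ^ 2 := Real.summable_one_div_int_pow.2 one_lt_two
    refine (h1.of_norm_bounded_eventually (f := f) ?_)
    filter_upwards [(finite_singleton (0:ℤ)).compl_mem_cofinite] with i hi
    have hi0 : (i:ℝ) ≠ 0 := by exact_mod_cast hi
    rw [Real.norm_of_nonneg (hf0 i).le, hf, one_div]
    have : 0 < (i:ℝ) ^ 2 := by positivity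
    refine inv_anti₀ this ?_
    rw [← sq_abs]
    gcongr
    linarith
  have hshift : ∀ (m : ℕ) (c : ℤ), ∑ j ∈ Finset.range m, f (j + c) ≤ ∑' i, f i := by
    intro m c
    have hinj : Function.Injective fun j : ℕ => (j:ℤ) + c := fun a b h => by
      simpa using h
    refine (Summable.sum_le_tsum _ (fun i _ => (hf0 _).le) (hsum.comp_injective hinj)).trans ?_
    exact (hsum.comp_injective hinj).tsum_le_tsum_of_inj _ hinj (fun i _ => (hf0 i).le)
      (fun _ => le_rfl) hsum
  have hS : 0 < ∑' i, f i := hsum.tsum_pos (fun i => (hf0 i).le) 0 (hf0 0)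
  refine ⟨3 * ∑' i, f i, by positivity, fun m k hk => ?_⟩
  have hle : ∀ j ∈ Finset.range m, ((1 + cycDist m j k) ^ 2)⁻¹ ≤
      f (j + (-k)) + f (j + (-k - m)) + f (j + (m - k)) := by
    intro j hj
    have hjm : j < m := Finset.mem_range.1 hj
    have h1 : (j:ℝ) < m := by exact_mod_cast hjm
    have h2 : (k:ℝ) < m := by exact_mod_cast hk
    have h3 : (0:ℝ) ≤ j := by positivity
    have h4 : (0:ℝ) ≤ k := by positivity
    have p1 := hf0 (j + (-k))
    have p2 := hf0 (j + (-k - m))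
    have p3 := hf0 (j + (m - k))
    rcases le_total (|(j:ℝ) - k|) (m - |(j:ℝ) - k|) with h | h
    · have e : ((1 + cycDist m j k) ^ 2)⁻¹ = f (j + (-k)) := by
        rw [cycDist, min_eq_left h, hf]
        push_cast
        rw [sub_eq_add_neg]
      linarith
    · rcases le_total (k:ℝ) j with hjk | hjk
      · have e : ((1 + cycDist m j k) ^ 2)⁻¹ = f (j + (-k - m)) := by
          rw [cycDist, min_eq_right h, hf, abs_of_nonneg (by linarith)]
          push_cast
          rw [abs_of_nonpos (by linarith)]
          congr 3
          ring
        linarith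
      · have e : ((1 + cycDist m j k) ^ 2)⁻¹ = f (j + (m - k)) := by
          rw [cycDist, min_eq_right h, hf, abs_of_nonpos (by linarith)]
          push_cast
          rw [abs_of_nonneg (by linarith)]
          congr 3
          ring
        linarith
  refine (Finset.sum_le_sum hle).trans ?_
  rw [Finset.sum_add_distrib, Finset.sum_add_distrib]
  have h1 := hshift m (-k)
  have h2 := hshift m (-k - m)
  have h3 := hshift m (m - k)
  linarith

end CyclicDistance

section Pieces

variable {Γ : Set ℂ} {Λ L lam : ℝ} {σ : ℝ → ℂ} {ν : Measure ℂ}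

/-- The `k`-th arc of length `h` of a curve parametrized by `σ`. -/
def arcPiece (σ : ℝ → ℂ) (h : ℝ) (k : ℕ) : Set ℂ := σ '' Icc (k * h) ((k + 1) * h)

theorem exists_mem_arcPiece (hσ : IsArclengthParam Γ Λ L σ) {m : ℕ} {h : ℝ}
    (hh : 0 < h) (hm : m * h = L) {z : ℂ} (hz : z ∈ Γ) : ∃ k < m, z ∈ arcPiece σ h k := by
  obtain ⟨t, ht, rfl⟩ := hσ.exists_mem_Ico 0 hz
  have ht0 : 0 ≤ t / h := div_nonneg ht.1 hh.le
  refine ⟨⌊t / h⌋₊, ?_, t, ⟨?_, ?_⟩, rfl⟩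
  · rw [Nat.floor_lt ht0, div_lt_iff₀ hh, hm]
    simpa using ht.2
  · rw [← le_div_iff₀ hh]
    exact Nat.floor_le ht0
  · rw [← div_le_iff₀ hh]
    exact (Nat.lt_floor_add_one _).le

theorem one_add_cycDist_le (hσ : IsArclengthParam Γ Λ L σ) (hΛ : 1 ≤ Λ) {m : ℕ} {h : ℝ}
    (hh : 0 < h) (hm : m * h = L) {j k : ℕ} (hj : j < m) (hk : k < m) {τ t : ℝ}
    (hτ : τ ∈ Icc (j * h) ((j + 1) * h)) (ht : t ∈ Icc (k * h) ((k + 1) * h)) :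
    1 + cycDist m j k ≤ (Λ + 2) * (1 + dist (σ t) (σ τ) / h) := by
  have hjm : (j:ℝ) + 1 ≤ m := by exact_mod_cast hj
  have hkm : (k:ℝ) + 1 ≤ m := by exact_mod_cast hk
  have hτ0 : 0 ≤ τ := le_trans (by positivity) hτ.1
  have ht0 : 0 ≤ t := le_trans (by positivity) ht.1
  have hτL : τ ≤ L := hτ.2.trans (hm ▸ by gcongr)
  have htL : t ≤ L := ht.2.trans (hm ▸ by gcongr)
  have hmin : min |t - τ| (L - |t - τ|) ≤ Λ * dist (σ t) (σ τ) := by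
    rcases le_total τ t with hle | hle
    · rw [abs_of_nonneg (by linarith), dist_comm]
      exact hσ.min_le τ t hle (by linarith)
    · rw [abs_of_nonpos (by linarith), neg_sub]
      exact hσ.min_le t τ hle (by linarith)
  have h1 : |((j:ℝ) - k) * h - (τ - t)| ≤ h := by
    rw [abs_le]
    constructor <;> linarith [hτ.1, hτ.2, ht.1, ht.2]
  have h2 : |(j:ℝ) - k| * h = |((j:ℝ) - k) * h| := by rw [abs_mul, abs_of_pos hh]
  have h3 := abs_sub_abs_le_abs_sub (((j:ℝ) - k) * h) (τ - t)
  have h4 := abs_sub_abs_le_abs_sub (τ - t) (((j:ℝ) - k) * h)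
  rw [abs_sub_comm (τ - t) (((j:ℝ) - k) * h)] at h4
  rw [abs_sub_comm t τ] at hmin
  have h5 : (cycDist m j k - 1) * h ≤ Λ * dist (σ t) (σ τ) := by
    have h6 : cycDist m j k * h ≤ |(j:ℝ) - k| * h := by
      gcongr
      exact min_le_left _ _
    have h7 : cycDist m j k * h ≤ (m - |(j:ℝ) - k|) * h := by
      gcongr
      exact min_le_right _ _
    rcases min_le_iff.1 hmin with h8 | h8 <;> linarith
  have h6 : cycDist m j k - 1 ≤ Λ * (dist (σ t) (σ τ) / h) := by
    rw [← mul_div_assoc, le_div_iff₀ hh]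
    exact h5
  have h7 : 0 ≤ dist (σ t) (σ τ) / h := by positivity
  linarith

theorem arcPiece_subset (hσ : IsArclengthParam Γ Λ L σ) {m : ℕ} {h : ℝ}
    (hh : 0 < h) (hm : m * h = L) {j k : ℕ} (hj : j < m) (hk : k < m) :
    arcPiece σ h j ⊆ σ '' Icc ((k + 1 / 2) * h - (cycDist m j k + 1 / 2) * h)
      ((k + 1 / 2) * h + (cycDist m j k + 1 / 2) * h) := by
  have hsub : ∀ (c R x y : ℝ), c - R ≤ x → y ≤ c + R → Icc x y ⊆ Icc (c - R) (c + R) :=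
    fun _ _ _ _ h1 h2 => Icc_subset_Icc h1 h2
  have hj0 : (0:ℝ) ≤ j * h := by positivity
  have hk0 : (0:ℝ) ≤ k * h := by positivity
  have hjm : (j:ℝ) * h ≤ m * h := by gcongr
  have hkm : (k:ℝ) * h ≤ m * h := by gcongr
  unfold arcPiece cycDist
  rcases le_total (|(j:ℝ) - k|) (m - |(j:ℝ) - k|) with h1 | h1
  · rw [min_eq_left h1]
    have h2 := neg_abs_le ((j:ℝ) - k)
    have h3 := le_abs_self ((j:ℝ) - k)
    refine image_mono (hsub _ _ _ _ ?_ ?_) <;> nlinarith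
  · rw [min_eq_right h1]
    rcases le_total (k:ℝ) j with hkj | hkj
    · rw [abs_of_nonneg (by linarith)] at h1 ⊢
      have h2 := hσ.image_Icc_add (j * h - L) ((j + 1) * h - L)
      rw [sub_add_cancel, sub_add_cancel] at h2
      rw [h2, ← hm]
      refine image_mono (hsub _ _ _ _ ?_ ?_) <;> nlinarith
    · rw [abs_of_nonpos (by linarith)] at h1 ⊢
      rw [← hσ.image_Icc_add, ← hm]
      refine image_mono (hsub _ _ _ _ ?_ ?_) <;> nlinarith

theorem measure_arcPiece_le (hσ : IsArclengthParam Γ Λ L σ) (hν : IsAInftyMeasure Γ ν lam)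
    {s₀ : ℕ} (hs₀ : lam ≤ 2 ^ s₀) {m : ℕ} {h : ℝ} (hh : 0 < h) (hm : m * h = L) {j k : ℕ}
    (hj : j < m) (hk : k < m) :
    ν (arcPiece σ h j) ≤
      ENNReal.ofReal (4 ^ s₀ * (1 + cycDist m j k) ^ s₀) * ν (arcPiece σ h k) := by
  have hc := cycDist_nonneg hj hk
  obtain ⟨i, hi1, hi2⟩ : ∃ i : ℕ, 2 * cycDist m j k + 1 ≤ 2 ^ i ∧
      (2:ℝ) ^ i ≤ 4 * (1 + cycDist m j k) := by
    obtain ⟨i, hi1, hi2⟩ := exists_nat_pow_near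
      (show 1 ≤ 2 * cycDist m j k + 1 by linarith) (one_lt_two (α := ℝ))
    refine ⟨i + 1, hi2.le, ?_⟩
    rw [pow_succ]
    linarith
  have h1 := hσ.measure_image_Icc_two_pow_mul_le hν ((k + 1 / 2) * h) (r := h / 2)
    (by positivity) i
  have h2 : σ '' Icc ((k + 1 / 2) * h - h / 2) ((k + 1 / 2) * h + h / 2) = arcPiece σ h k := by
    unfold arcPiece
    congr 2 <;> ring
  rw [h2] at h1
  have hlam : 0 ≤ lam := zero_le_one.trans hν.1
  calc ν (arcPiece σ h j) ≤ ν (σ '' Icc ((k + 1 / 2) * h - 2 ^ i * (h / 2))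
        ((k + 1 / 2) * h + 2 ^ i * (h / 2))) := by
        refine measure_mono ((arcPiece_subset hσ hh hm hj hk).trans (image_mono ?_))
        refine Icc_subset_Icc ?_ ?_ <;> nlinarith
    _ ≤ _ := h1
    _ ≤ _ := by
        gcongr
        rw [← ENNReal.ofReal_pow hlam]
        refine ENNReal.ofReal_le_ofReal ?_
        calc lam ^ i ≤ (2 ^ s₀) ^ i := by gcongr
          _ = (2 ^ i) ^ s₀ := pow_right_comm _ _ _
          _ ≤ (4 * (1 + cycDist m j k)) ^ s₀ := by gcongr
          _ = _ := mul_pow _ _ _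

/-- An `ℓᵖ` form of the local Bernstein–Walsh inequality over the arcs of a partition. -/
theorem norm_eval_rpow_le_sum {s : ℕ} (hs : 1 ≤ s) (hσ : IsArclengthParam Γ Λ L σ) (hΛ : 1 ≤ Λ)
    {Φ : ℂ → ℂ} (hΦ : IsExtConformal (unboundedComponent Γ) Φ) {n : ℕ} (hn : 1 ≤ n)
    {P : Polynomial ℂ} (hP : P.natDegree ≤ n) {m : ℕ} {h : ℝ} (hh : 0 < h) (hm : m * h = L)
    (hmΛ : Λ ≤ m)
    (hhd : h < setDist Γ (levelCurve (unboundedComponent Γ) Φ (1 / (n:ℝ))))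
    {p : ℝ} (hp : 1 ≤ p) {a : ℕ → ℝ} (ha0 : ∀ k, 0 ≤ a k)
    (ha : ∀ k < m, ∀ z ∈ arcPiece σ h k, ‖P.eval z‖ ≤ a k) {j : ℕ} (hj : j < m) {z₀ : ℂ}
    (hz₀ : z₀ ∈ arcPiece σ h j) {ζ : ℂ} (hζ : ζ ∈ closedBall z₀ h) :
    ‖P.eval ζ‖ ^ p ≤ (6 * (8 / poleRadius s) ^ s * (Λ + 2) ^ s) ^ p *
      ∑ k ∈ Finset.range m, a k ^ p * ((1 + cycDist m j k) ^ s)⁻¹ := by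
  have hp0 : 0 < p := by linarith
  have hc : ∀ k ∈ Finset.range m, 0 ≤ cycDist m j k := fun k hk =>
    cycDist_nonneg hj (Finset.mem_range.1 hk)
  set B := ∑ k ∈ Finset.range m, a k ^ p * ((1 + cycDist m j k) ^ s)⁻¹ with hB
  have hterm : ∀ k ∈ Finset.range m, 0 ≤ a k ^ p * ((1 + cycDist m j k) ^ s)⁻¹ := by
    intro k hk
    have := hc k hk
    have := ha0 k
    positivity
  have hB0 : 0 ≤ B := Finset.sum_nonneg hterm
  have hpole := poleRadius_pos hs
  obtain ⟨τ, hτ, rfl⟩ := hz₀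
  have hak : ∀ k < m, a k ≤ B ^ (1 / p) * (1 + cycDist m j k) ^ s := by
    intro k hk
    have hk' := Finset.mem_range.2 hk
    have hck := hc k hk'
    have h1 : a k ^ p * ((1 + cycDist m j k) ^ s)⁻¹ ≤ B := Finset.single_le_sum hterm hk'
    rw [← div_eq_mul_inv, div_le_iff₀ (by positivity)] at h1
    have h2 := Real.rpow_le_rpow (by have := ha0 k; positivity) h1
      (show 0 ≤ 1 / p by positivity)
    rw [← Real.rpow_mul (ha0 k), mul_one_div_cancel hp0.ne', Real.rpow_one,
      Real.mul_rpow hB0 (by positivity)] at h2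
    refine h2.trans ?_
    gcongr
    refine (Real.rpow_le_rpow_of_exponent_le (one_le_pow₀ (by linarith))
      (show 1 / p ≤ 1 from (div_le_one hp0).2 hp)).trans ?_
    rw [Real.rpow_one]
  have hA : ∀ z ∈ Γ, ‖P.eval z‖ ≤
      (Λ + 2) ^ s * B ^ (1 / p) * (1 + dist z (σ τ) / h) ^ s := by
    intro z hz
    obtain ⟨k, hk, hzk⟩ := exists_mem_arcPiece hσ hh hm hz
    refine (ha k hk z hzk).trans ((hak k hk).trans ?_)
    obtain ⟨t, ht, rfl⟩ := hzk
    have h1 := one_add_cycDist_le hσ hΛ hh hm hj hk hτ ht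
    have h2 := hc k (Finset.mem_range.2 hk)
    rw [mul_comm ((Λ + 2) ^ s), mul_assoc, ← mul_pow]
    gcongr
  have hfar : ∃ z' ∈ Γ, h / 2 ≤ dist z' (σ τ) := by
    refine ⟨σ (τ + L / 2), hσ.apply_mem _, ?_⟩
    have hL := hσ.pos
    have h1 := hσ.min_le τ (τ + L / 2) (by linarith) (by linarith)
    have e1 : τ + L / 2 - τ = L / 2 := by ring
    have e2 : L - L / 2 = L / 2 := by ring
    rw [e1, e2, min_self, dist_comm] at h1
    have h2 : Λ * h ≤ L := hm ▸ by gcongr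
    refine le_of_mul_le_mul_left (a := Λ) ?_ (by linarith)
    linarith
  have hmain := hΦ.norm_eval_le_of_dist_le hs hσ.isCompact hσ.isPreconnected hn hP
    (hσ.apply_mem τ) hh hhd hfar hA hζ
  calc ‖P.eval ζ‖ ^ p ≤ (6 * (8 / poleRadius s) ^ s * ((Λ + 2) ^ s * B ^ (1 / p))) ^ p := by
        gcongr
    _ = _ := by
        rw [← mul_assoc, Real.mul_rpow (by positivity) (by positivity), ← Real.rpow_mul hB0,
          one_div_mul_cancel hp0.ne', Real.rpow_one]

end Pieces

section Nikolskii

variable {Γ : Set ℂ} {Λ L lam : ℝ} {σ : ℝ → ℂ} {ν : Measure ℂ}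

theorem sum_mul_sum_cycDist_le (hσ : IsArclengthParam Γ Λ L σ) (hν : IsAInftyMeasure Γ ν lam)
    [IsFiniteMeasure ν] {s₀ : ℕ} (hs₀ : lam ≤ 2 ^ s₀) {S : ℝ}
    (hS : ∀ m k, k < m → ∑ j ∈ Finset.range m, ((1 + cycDist m j k) ^ 2)⁻¹ ≤ S)
    {m : ℕ} {h : ℝ} (hh : 0 < h) (hm : m * h = L) {θ : ℝ} (hθ0 : 0 ≤ θ) (hθ1 : θ ≤ 1)
    {x : ℕ → ℝ} (hx : ∀ k, 0 ≤ x k) :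
    ∑ j ∈ Finset.range m, (∑ k ∈ Finset.range m, x k * ((1 + cycDist m j k) ^ (s₀ + 2))⁻¹) *
        (ν (arcPiece σ h j)).toReal ^ θ ≤
      4 ^ s₀ * S * ∑ k ∈ Finset.range m, x k * (ν (arcPiece σ h k)).toReal ^ θ := by
  have hV : ∀ j ∈ Finset.range m, ∀ k ∈ Finset.range m, (ν (arcPiece σ h j)).toReal ^ θ ≤
      4 ^ s₀ * (1 + cycDist m j k) ^ s₀ * (ν (arcPiece σ h k)).toReal ^ θ := by
    intro j hj k hk
    have hjm := Finset.mem_range.1 hj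
    have hkm := Finset.mem_range.1 hk
    have hc := cycDist_nonneg hjm hkm
    have h1 := ENNReal.toReal_mono (by finiteness) (measure_arcPiece_le hσ hν hs₀ hh hm hjm hkm)
    rw [ENNReal.toReal_mul, ENNReal.toReal_ofReal (by positivity)] at h1
    have h2 := Real.rpow_le_rpow ENNReal.toReal_nonneg h1 hθ0
    rw [Real.mul_rpow (by positivity) ENNReal.toReal_nonneg] at h2
    refine h2.trans ?_
    gcongr
    have h3 : 1 ≤ (4:ℝ) ^ s₀ * (1 + cycDist m j k) ^ s₀ :=
      one_le_mul_of_one_le_of_one_le (one_le_pow₀ (by norm_num)) (one_le_pow₀ (by linarith))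
    exact (Real.rpow_le_rpow_of_exponent_le h3 hθ1).trans (Real.rpow_one _).le
  simp_rw [Finset.sum_mul]
  rw [Finset.sum_comm, Finset.mul_sum]
  refine Finset.sum_le_sum fun k hk => ?_
  have hkm := Finset.mem_range.1 hk
  calc ∑ j ∈ Finset.range m, x k * ((1 + cycDist m j k) ^ (s₀ + 2))⁻¹ *
        (ν (arcPiece σ h j)).toReal ^ θ
      ≤ ∑ j ∈ Finset.range m, 4 ^ s₀ * (x k * (ν (arcPiece σ h k)).toReal ^ θ) *
        ((1 + cycDist m j k) ^ 2)⁻¹ := by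
        refine Finset.sum_le_sum fun j hj => ?_
        have hc := cycDist_nonneg (Finset.mem_range.1 hj) hkm
        have hxk := hx k
        calc x k * ((1 + cycDist m j k) ^ (s₀ + 2))⁻¹ * (ν (arcPiece σ h j)).toReal ^ θ
            ≤ x k * ((1 + cycDist m j k) ^ (s₀ + 2))⁻¹ *
              (4 ^ s₀ * (1 + cycDist m j k) ^ s₀ * (ν (arcPiece σ h k)).toReal ^ θ) := by
              gcongr
              exact hV j hj k hk
          _ = _ := by
              rw [pow_add]
              field_simp
    _ = 4 ^ s₀ * (x k * (ν (arcPiece σ h k)).toReal ^ θ) *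
        ∑ j ∈ Finset.range m, ((1 + cycDist m j k) ^ 2)⁻¹ := (Finset.mul_sum _ _ _).symm
    _ ≤ 4 ^ s₀ * (x k * (ν (arcPiece σ h k)).toReal ^ θ) * S := by
        have hxk := hx k
        gcongr
        exact hS m k hkm
    _ = _ := by ring

theorem aedisjoint_arcPiece (hσ : IsArclengthParam Γ Λ L σ) {m : ℕ} {h : ℝ} (hh : 0 < h)
    (hm : m * h = L) {j k : ℕ} (hj : j < m) (hk : k < m) (hjk : j ≠ k) :
    AEDisjoint μH[1] (arcPiece σ h j) (arcPiece σ h k) := by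
  have : NullSingletonClass (μH[1] : Measure ℂ) :=
    Measure.nullSingletonClass_hausdorff ℂ one_pos
  have key : ∀ j k : ℕ, j < k → k < m → AEDisjoint μH[1] (arcPiece σ h j) (arcPiece σ h k) := by
    intro j k hjk hk
    have hjk' : (j:ℝ) + 1 ≤ k := by exact_mod_cast hjk
    have hkm : (k:ℝ) + 1 ≤ m := by exact_mod_cast hk
    have h1 : ((j:ℝ) + 1) * h ≤ k * h := by gcongr
    have h2 : ((k:ℝ) + 1) * h ≤ m * h := by gcongr
    have h3 : (0:ℝ) ≤ j * h := by positivity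
    have h4 := hσ.image_Icc_inter (a := j * h) (b := (j + 1) * h) (c := (k + 1) * h)
      (by linarith)
    refine measure_mono_null (Subset.trans (inter_subset_inter_right _ ?_) h4)
      ((toFinite _).countable.measure_zero _)
    exact image_mono (Icc_subset_Icc h1 le_rfl)
  rcases hjk.lt_or_gt with h | h
  · exact key j k h hk
  · exact (key k j h hj).symm

theorem arcPiece_subset_curve (hσ : IsArclengthParam Γ Λ L σ) (h : ℝ) (k : ℕ) :
    arcPiece σ h k ⊆ Γ := (hσ.isSubarc _ _).1

theorem sum_le_integral_of_subset_arcPiece (hσ : IsArclengthParam Γ Λ L σ) {m : ℕ} {h : ℝ}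
    (hh : 0 < h) (hm : m * h = L) {f : ℂ → ℝ} (hf0 : ∀ z, 0 ≤ f z)
    (hf : IntegrableOn f Γ μH[1]) {c : ℕ → ℝ} (hc : ∀ j, 0 ≤ c j) {J : ℕ → Set ℂ}
    (hJm : ∀ j, MeasurableSet (J j)) (hJ : ∀ j < m, J j ⊆ arcPiece σ h j)
    (hcJ : ∀ j < m, ENNReal.ofReal (c j) ≤ ∫⁻ z in J j, ENNReal.ofReal (f z) ∂μH[1]) :
    ∑ j ∈ Finset.range m, c j ≤ ∫ z in Γ, f z ∂μH[1] := by
  rw [← ENNReal.ofReal_le_ofReal_iff (integral_nonneg hf0),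
    ofReal_integral_eq_lintegral_ofReal hf (.of_forall hf0),
    ENNReal.ofReal_sum_of_nonneg fun j _ => hc j]
  calc ∑ j ∈ Finset.range m, ENNReal.ofReal (c j)
      ≤ ∑ j ∈ Finset.range m,
          ((μH[1] : Measure ℂ).withDensity fun z => ENNReal.ofReal (f z)) (J j) := by
        refine Finset.sum_le_sum fun j hj => ?_
        rw [withDensity_apply _ (hJm j)]
        exact hcJ j (Finset.mem_range.1 hj)
    _ = ((μH[1] : Measure ℂ).withDensity fun z => ENNReal.ofReal (f z))
          (⋃ j ∈ Finset.range m, J j) := by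
        refine (measure_biUnion_finset₀ ?_ fun j _ => (hJm j).nullMeasurableSet).symm
        intro j hj k hk hjk
        have hj' := Finset.mem_range.1 (Finset.mem_coe.1 hj)
        have hk' := Finset.mem_range.1 (Finset.mem_coe.1 hk)
        exact withDensity_absolutelyContinuous _ _
          (((aedisjoint_arcPiece hσ hh hm hj' hk' hjk)).mono (hJ j hj') (hJ k hk'))
    _ = ∫⁻ z in ⋃ j ∈ Finset.range m, J j, ENNReal.ofReal (f z) ∂μH[1] :=
        withDensity_apply _ (Finset.measurableSet_biUnion _ fun j _ => hJm j)
    _ ≤ _ := lintegral_mono_set (iUnion₂_subset fun j hj =>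
        (hJ j (Finset.mem_range.1 hj)).trans (arcPiece_subset_curve hσ h j))

theorem measurableSet_arcPiece (hσ : IsArclengthParam Γ Λ L σ) (h : ℝ) (k : ℕ) :
    MeasurableSet (arcPiece σ h k) := hσ.measurableSet_image_Icc _ _

theorem integral_rpow_mul_le_sum (hσ : IsArclengthParam Γ Λ L σ) {m : ℕ} {h : ℝ}
    (hh : 0 < h) (hm : m * h = L) {w : ℂ → ℝ} (hw : Measurable w) (hw0 : ∀ z, 0 ≤ w z)
    (hνw : ν = ((μH[1] : Measure ℂ).restrict Γ).withDensity (fun z => ENNReal.ofReal (w z)))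
    [IsFiniteMeasure ν] {P : Polynomial ℂ} {q : ℝ} (hq : 0 ≤ q) {a : ℕ → ℝ} (ha0 : ∀ k, 0 ≤ a k)
    (ha : ∀ k < m, ∀ z ∈ arcPiece σ h k, ‖P.eval z‖ ≤ a k) :
    ∫ z in Γ, ‖P.eval z‖ ^ q * w z ∂μH[1] ≤
      ∑ k ∈ Finset.range m, a k ^ q * (ν (arcPiece σ h k)).toReal := by
  have hf0 : ∀ z, 0 ≤ ‖P.eval z‖ ^ q * w z := fun z => by
    have := hw0 z
    positivity
  have hsum0 : ∀ k ∈ Finset.range m, 0 ≤ a k ^ q * (ν (arcPiece σ h k)).toReal := fun k _ => by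
    have := ha0 k
    positivity
  have hmeas : Measurable fun z => ‖P.eval z‖ ^ q * w z := by
    have : Measurable fun z => P.eval z := P.continuous.measurable
    fun_prop
  rw [integral_eq_lintegral_of_nonneg_ae (.of_forall hf0) hmeas.aestronglyMeasurable]
  refine ENNReal.toReal_le_of_le_ofReal (Finset.sum_nonneg hsum0) ?_
  rw [ENNReal.ofReal_sum_of_nonneg hsum0]
  calc ∫⁻ z in Γ, ENNReal.ofReal (‖P.eval z‖ ^ q * w z) ∂μH[1]
      ≤ ∫⁻ z in ⋃ k ∈ Finset.range m, arcPiece σ h k,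
          ENNReal.ofReal (‖P.eval z‖ ^ q * w z) ∂μH[1] := by
        refine lintegral_mono_set fun z hz => ?_
        obtain ⟨k, hk, hzk⟩ := exists_mem_arcPiece hσ hh hm hz
        exact mem_iUnion₂.2 ⟨k, Finset.mem_range.2 hk, hzk⟩
    _ = ((μH[1] : Measure ℂ).withDensity fun z => ENNReal.ofReal (‖P.eval z‖ ^ q * w z))
          (⋃ k ∈ Finset.range m, arcPiece σ h k) :=
        (withDensity_apply _ (Finset.measurableSet_biUnion _ fun k _ =>
          measurableSet_arcPiece hσ h k)).symm
    _ ≤ ∑ k ∈ Finset.range m,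
          ((μH[1] : Measure ℂ).withDensity fun z => ENNReal.ofReal (‖P.eval z‖ ^ q * w z))
            (arcPiece σ h k) := measure_biUnion_finset_le _ _
    _ ≤ _ := by
        refine Finset.sum_le_sum fun k hk => ?_
        have hak := ha0 k
        rw [ENNReal.ofReal_mul (by positivity), ENNReal.ofReal_toReal (measure_ne_top ν _), hνw,
          withDensity_apply _ (measurableSet_arcPiece hσ h k),
          withDensity_apply _ (measurableSet_arcPiece hσ h k),
          Measure.restrict_restrict (measurableSet_arcPiece hσ h k),
          inter_eq_left.2 (arcPiece_subset_curve hσ h k), ← lintegral_const_mul _ (by fun_prop)]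
        refine setLIntegral_mono (by fun_prop) fun z hz => ?_
        rw [← ENNReal.ofReal_mul (by positivity)]
        refine ENNReal.ofReal_le_ofReal ?_
        have h1 := ha k (Finset.mem_range.1 hk) z hz
        have h2 := hw0 z
        gcongr

theorem integrableOn_rpow_mul_rpow (hσ : IsArclengthParam Γ Λ L σ) {w : ℂ → ℝ}
    (hw : Measurable w) (hw0 : ∀ z, 0 ≤ w z)
    (hνw : ν = ((μH[1] : Measure ℂ).restrict Γ).withDensity (fun z => ENNReal.ofReal (w z)))
    [IsFiniteMeasure ν] (P : Polynomial ℂ) {p θ : ℝ} (hp : 0 ≤ p) (hθ0 : 0 ≤ θ) (hθ1 : θ ≤ 1) :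
    IntegrableOn (fun z => ‖P.eval z‖ ^ p * w z ^ θ) Γ μH[1] := by
  have hwi : IntegrableOn w Γ μH[1] := by
    refine ⟨hw.aestronglyMeasurable, ?_⟩
    have h1 := measure_lt_top ν univ
    rw [hνw, withDensity_apply _ MeasurableSet.univ, Measure.restrict_univ] at h1
    rwa [hasFiniteIntegral_iff_ofReal (.of_forall hw0)]
  have hΓ : μH[1] Γ ≠ ∞ := by
    rw [← hσ.image_Icc_eq (a := 0) (b := L) (by simp), hσ.length_eq_min hσ.pos.le]
    exact ENNReal.ofReal_ne_top
  have h1i : IntegrableOn (fun _ => (1:ℝ)) Γ μH[1] := integrableOn_const hΓ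
  obtain ⟨M, hM⟩ := hσ.isCompact.exists_bound_of_continuousOn P.continuous.continuousOn
  have hΓm : MeasurableSet Γ := hσ.isCompact.isClosed.measurableSet
  refine Integrable.mono' ((h1i.add hwi).const_mul (M ^ p)) ?_ ?_
  · have : Measurable fun z => P.eval z := P.continuous.measurable
    exact (by fun_prop : Measurable fun z => ‖P.eval z‖ ^ p * w z ^ θ).aestronglyMeasurable
  · refine (ae_restrict_iff' hΓm).2 (.of_forall fun z hz => ?_)
    have h1 := hM z hz
    have h2 := hw0 z
    have hM0 : 0 ≤ M := (norm_nonneg _).trans h1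
    rw [Real.norm_of_nonneg (by positivity)]
    have h3 : w z ^ θ ≤ 1 + w z := by
      rcases le_total (w z) 1 with h | h
      · linarith [Real.rpow_le_one h2 h hθ0]
      · have := Real.rpow_le_rpow_of_exponent_le h hθ1
        rw [Real.rpow_one] at this
        linarith
    calc ‖P.eval z‖ ^ p * w z ^ θ ≤ M ^ p * (1 + w z) := by gcongr
      _ = _ := rfl

end Nikolskii

section Main

variable {Γ : Set ℂ} {Λ L lam : ℝ} {σ : ℝ → ℂ} {ν : Measure ℂ}

theorem exists_subset_arcPiece_le_lintegral (hσ : IsArclengthParam Γ Λ L σ)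
    {w : ℂ → ℝ} (hw : Measurable w) (hw0 : ∀ z, 0 ≤ w z)
    (hνw : ν = ((μH[1] : Measure ℂ).restrict Γ).withDensity (fun z => ENNReal.ofReal (w z)))
    (hν : IsAInftyMeasure Γ ν lam) [IsFiniteMeasure ν] {p θ : ℝ} (hp : 0 < p) (hθ0 : 0 < θ)
    (hθ1 : θ ≤ 1) {m : ℕ} {h : ℝ} (hh : 0 < h) (hm : m * h = L) {j : ℕ} (hj : j < m)
    {P : Polynomial ℂ} {M τ : ℝ} (hτ : τ ∈ Icc (j * h) ((j + 1) * h))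
    (hM : ∀ ζ ∈ closedBall (σ τ) h, ‖P.eval ζ‖ ≤ M) {i : ℕ} (hi : 1 ≤ i) :
    ∃ J, MeasurableSet J ∧ J ⊆ arcPiece σ h j ∧
      ENNReal.ofReal (1 / (lam ^ (i + 1) * 4 * lam * 2 ^ i) * h ^ (1 - θ) *
        (max (‖P.eval (σ τ)‖ - 2 / 2 ^ i * M) 0 ^ p * (ν (arcPiece σ h j)).toReal ^ θ)) ≤
      ∫⁻ z in J, ENNReal.ofReal (‖P.eval z‖ ^ p * w z ^ θ) ∂μH[1] := by
  have hlam := hν.1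
  have hlam0 : 0 < lam := by linarith
  have hjm : (j:ℝ) + 1 ≤ m := by exact_mod_cast hj
  have hhL : h ≤ L := by
    have : (0:ℝ) ≤ j := by positivity
    rw [← hm]
    nlinarith
  have hM0 : 0 ≤ M := (norm_nonneg _).trans (hM (σ τ) (mem_closedBall_self hh.le))
  have h2i : (2:ℝ) ≤ 2 ^ i := le_self_pow₀ one_le_two (by omega)
  set ℓ := h / 2 ^ i with hℓ
  have hℓ0 : 0 < ℓ := by positivity
  have hℓh : ℓ ≤ h / 2 := by rw [hℓ]; gcongr
  have hℓi : 2 ^ i * ℓ = h := by rw [hℓ]; field_simp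
  obtain ⟨α, hα1, hα2, hα3, hα4⟩ : ∃ α, j * h ≤ α ∧ α + ℓ ≤ (j + 1) * h ∧ α ≤ τ ∧ τ ≤ α + ℓ := by
    rcases le_total τ ((j + 1 / 2) * h) with h1 | h1
    · exact ⟨τ, hτ.1, by linarith, le_rfl, by linarith⟩
    · exact ⟨τ - ℓ, by linarith, by linarith [hτ.2], by linarith, by linarith⟩
  set J := σ '' Icc α (α + ℓ) with hJ
  have hJm : MeasurableSet J := hσ.measurableSet_image_Icc _ _
  refine ⟨J, hJm, image_mono (Icc_subset_Icc hα1 hα2), ?_⟩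
  set β := max (‖P.eval (σ τ)‖ - 2 / 2 ^ i * M) 0 with hβ
  have hβ0 : 0 ≤ β := le_max_right _ _
  have hPβ : ∀ z ∈ J, β ≤ ‖P.eval z‖ := by
    rintro _ ⟨t, ht, rfl⟩
    refine max_le ?_ (norm_nonneg _)
    have hd : dist (σ t) (σ τ) ≤ ℓ := by
      rcases le_total t τ with h1 | h1
      · exact (hσ.dist_le h1 (by linarith [ht.1])).trans (by linarith [ht.1])
      · rw [dist_comm]
        exact (hσ.dist_le h1 (by linarith [ht.2])).trans (by linarith [ht.2])
    have h2 := (dist_eval_le_of_forall_ball (fun ζ hζ => hM ζ (ball_subset_closedBall hζ))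
      (mem_ball.2 (by linarith : dist (σ t) (σ τ) < h))).2
    have h3 : 2 * M / h * dist (σ t) (σ τ) ≤ 2 / 2 ^ i * M := by
      calc 2 * M / h * dist (σ t) (σ τ) ≤ 2 * M / h * ℓ := by gcongr
        _ = 2 / 2 ^ i * M := by rw [hℓ]; field_simp
    linarith
  have hN : (ν (arcPiece σ h j)).toReal ≤ lam ^ (i + 1) * (ν J).toReal := by
    have h1 := hσ.measure_image_Icc_two_pow_mul_le hν (α + ℓ / 2) (r := ℓ / 2) (by positivity)
      (i + 1)
    have e1 : (2:ℝ) ^ (i + 1) * (ℓ / 2) = h := by rw [← hℓi]; ring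
    have e2 : α + ℓ / 2 - ℓ / 2 = α := by ring
    have e3 : α + ℓ / 2 + ℓ / 2 = α + ℓ := by ring
    rw [e1, e2, e3] at h1
    have h2 : ν (arcPiece σ h j) ≤ ENNReal.ofReal lam ^ (i + 1) * ν J := by
      refine (measure_mono (image_mono ?_)).trans h1
      exact Icc_subset_Icc (by linarith) (by linarith)
    have h3 := ENNReal.toReal_mono (by finiteness) h2
    rwa [ENNReal.toReal_mul, ENNReal.toReal_pow, ENNReal.toReal_ofReal hlam0.le] at h3
  have hreal : 1 / (lam ^ (i + 1) * 4 * lam * 2 ^ i) * h ^ (1 - θ) *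
      (ν (arcPiece σ h j)).toReal ^ θ ≤ ℓ / 2 * ((ν J).toReal / (2 * lam * ℓ)) ^ θ := by
    have h1 : (ν (arcPiece σ h j)).toReal ^ θ ≤ lam ^ (i + 1) * (ν J).toReal ^ θ := by
      refine (Real.rpow_le_rpow ENNReal.toReal_nonneg hN hθ0.le).trans ?_
      rw [Real.mul_rpow (by positivity) ENNReal.toReal_nonneg]
      gcongr
      exact (Real.rpow_le_rpow_of_exponent_le (one_le_pow₀ hlam) hθ1).trans (Real.rpow_one _).le
    have h2 : (2 * lam * ℓ) ^ θ ≤ 2 * lam * h ^ θ := by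
      rw [Real.mul_rpow (by positivity) hℓ0.le]
      gcongr
      · exact (Real.rpow_le_rpow_of_exponent_le (by linarith) hθ1).trans (Real.rpow_one _).le
      · linarith
    have h3 : h ^ (1 - θ) = h / h ^ θ := by rw [Real.rpow_sub hh, Real.rpow_one]
    have h4 : 0 < h ^ θ := by positivity
    calc 1 / (lam ^ (i + 1) * 4 * lam * 2 ^ i) * h ^ (1 - θ) * (ν (arcPiece σ h j)).toReal ^ θ
        ≤ 1 / (lam ^ (i + 1) * 4 * lam * 2 ^ i) * h ^ (1 - θ) *
          (lam ^ (i + 1) * (ν J).toReal ^ θ) := by gcongr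
      _ = ℓ / 2 * ((ν J).toReal ^ θ / (2 * lam * h ^ θ)) := by
          rw [h3, hℓ]
          field_simp
          ring
      _ ≤ ℓ / 2 * ((ν J).toReal ^ θ / (2 * lam * ℓ) ^ θ) := by gcongr
      _ = _ := by rw [Real.div_rpow ENNReal.toReal_nonneg (by positivity)]
  have hw' := hσ.le_lintegral_rpow hw hνw hν hθ0 (a := α) (b := α + ℓ) (by linarith)
    (by linarith)
  rw [add_sub_cancel_left, ← hJ] at hw'
  calc ENNReal.ofReal (1 / (lam ^ (i + 1) * 4 * lam * 2 ^ i) * h ^ (1 - θ) *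
        (β ^ p * (ν (arcPiece σ h j)).toReal ^ θ))
      ≤ ENNReal.ofReal (β ^ p * (ℓ / 2 * ((ν J).toReal / (2 * lam * ℓ)) ^ θ)) := by
        refine ENNReal.ofReal_le_ofReal ?_
        rw [mul_left_comm]
        gcongr
    _ = ENNReal.ofReal (β ^ p) *
          ENNReal.ofReal (ℓ / 2 * ((ν J).toReal / (2 * lam * ℓ)) ^ θ) :=
        ENNReal.ofReal_mul (by positivity)
    _ ≤ ENNReal.ofReal (β ^ p) * ∫⁻ z in J, ENNReal.ofReal (w z ^ θ) ∂μH[1] := by gcongr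
    _ = ∫⁻ z in J, ENNReal.ofReal (β ^ p) * ENNReal.ofReal (w z ^ θ) ∂μH[1] :=
        (lintegral_const_mul _ (by fun_prop)).symm
    _ ≤ _ := by
        have : Measurable fun z => P.eval z := P.continuous.measurable
        refine setLIntegral_mono (by fun_prop) fun z hz => ?_
        rw [← ENNReal.ofReal_mul (by positivity)]
        refine ENNReal.ofReal_le_ofReal ?_
        have h1 := hPβ z hz
        have h2 := hw0 z
        gcongr

theorem sum_rpow_le_rpow_sum (t : Finset ℕ) {x : ℕ → ℝ} (hx : ∀ j, 0 ≤ x j) {r : ℝ}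
    (hr : 1 ≤ r) : ∑ j ∈ t, x j ^ r ≤ (∑ j ∈ t, x j) ^ r := by
  induction t using Finset.induction_on with
  | empty => simp [Real.zero_rpow (by linarith : r ≠ 0)]
  | insert a t ha ih =>
    rw [Finset.sum_insert ha, Finset.sum_insert ha]
    exact (add_le_add_right ih _).trans
      (Real.add_rpow_le_rpow_add (hx a) (Finset.sum_nonneg fun j _ => hx j) hr)

theorem rpow_le_of_le_add {x b M ε p : ℝ} (hx : 0 ≤ x) (hb : 0 ≤ b) (hM : 0 ≤ M) (hε : 0 ≤ ε)
    (hε1 : 2 * ε ≤ 1) (hp : 1 ≤ p) (h : x ≤ b + ε * M) :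
    x ^ p ≤ 2 ^ p * b ^ p + 2 * ε * M ^ p := by
  have hp0 : 0 < p := by linarith
  have h1 : 2 ^ p * (ε * M) ^ p ≤ 2 * ε * M ^ p := by
    rw [← Real.mul_rpow (by norm_num) (by positivity), ← mul_assoc,
      Real.mul_rpow (by positivity) hM]
    gcongr
    exact (Real.rpow_le_rpow_of_exponent_ge_of_imp (by positivity) hε1 hp
      (fun _ h0 => by linarith)).trans (Real.rpow_one _).le
  rcases le_total b (ε * M) with h2 | h2
  · have h3 : x ^ p ≤ (2 * (ε * M)) ^ p := by
      gcongr
      linarith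
    rw [Real.mul_rpow (by norm_num) (by positivity)] at h3
    have : 0 ≤ 2 ^ p * b ^ p := by positivity
    linarith
  · have h3 : x ^ p ≤ (2 * b) ^ p := by
      gcongr
      linarith
    rw [Real.mul_rpow (by norm_num) hb] at h3
    have : 0 ≤ 2 * ε * M ^ p := by positivity
    linarith

theorem exists_nikolskii_const (hσ : IsArclengthParam Γ Λ L σ) (hΛ : 1 ≤ Λ)
    {Φ : ℂ → ℂ} (hΦ : IsExtConformal (unboundedComponent Γ) Φ) (hlam : 1 ≤ lam) {p q : ℝ}
    (hp : 1 ≤ p) (hpq : p < q) :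
    ∃ C > 0, ∀ (w : ℂ → ℝ) (ν : Measure ℂ), Measurable w → (∀ z, 0 ≤ w z) →
      ν = ((μH[1] : Measure ℂ).restrict Γ).withDensity (fun z => ENNReal.ofReal (w z)) →
      IsAInftyMeasure Γ ν lam → IsFiniteMeasure ν →
      ∀ (n : ℕ) (P : Polynomial ℂ), 1 ≤ n → P.natDegree ≤ n → ∀ (m : ℕ) (h : ℝ), 0 < h →
        m * h = L → Λ ≤ m → h < setDist Γ (levelCurve (unboundedComponent Γ) Φ (1 / (n:ℝ))) →
        (∫ z in Γ, ‖P.eval z‖ ^ q * w z ∂μH[1]) ^ (1 / q) ≤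
          C * h ^ (1 / q - 1 / p) *
            (∫ z in Γ, ‖P.eval z‖ ^ p * w z ^ (p / q) ∂μH[1]) ^ (1 / p) := by
  have hp0 : 0 < p := by linarith
  have hq0 : 0 < q := by linarith
  set θ := p / q with hθ
  have hθ0 : 0 < θ := by positivity
  have hθ1 : θ ≤ 1 := (div_le_one hq0).2 hpq.le
  obtain ⟨s₀, hs₀⟩ := pow_unbounded_of_one_lt lam (one_lt_two (α := ℝ))
  obtain ⟨S, hS0, hS⟩ := exists_sum_cycDist_le
  have hpole := poleRadius_pos (s := s₀ + 2) (by omega)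
  set K := (6 * (8 / poleRadius (s₀ + 2)) ^ (s₀ + 2) * (Λ + 2) ^ (s₀ + 2)) ^ p with hK
  have hK0 : 0 < K := by positivity
  obtain ⟨i, hi⟩ := pow_unbounded_of_one_lt (8 * (K * (4 ^ s₀ * S)) + 4) (one_lt_two (α := ℝ))
  have hKS : 0 < K * (4 ^ s₀ * S) := by positivity
  have hi1 : 1 ≤ i := by
    by_contra h0
    have : i = 0 := by omega
    rw [this, pow_zero] at hi
    linarith
  set c := 1 / (lam ^ (i + 1) * 4 * lam * 2 ^ i) with hc
  have hc0 : 0 < c := by positivity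
  refine ⟨(2 ^ (p + 1) / c) ^ (1 / p), by positivity, ?_⟩
  intro w ν hw hw0 hνw hν hfin n P hn hP m h hh hm hmΛ hhd
  have hτ : ∀ j : ℕ, ∃ τ ∈ Icc (j * h) ((j + 1) * h),
      ∀ z ∈ arcPiece σ h j, ‖P.eval z‖ ≤ ‖P.eval (σ τ)‖ := by
    intro j
    have hcont : Continuous fun t => ‖P.eval (σ t)‖ :=
      (P.continuous.comp hσ.continuous).norm
    obtain ⟨τ, hτ, hmax⟩ := (isCompact_Icc (a := j * h) (b := (j + 1) * h)).exists_isMaxOn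
      (nonempty_Icc.2 (by gcongr; linarith)) hcont.continuousOn
    refine ⟨τ, hτ, ?_⟩
    rintro _ ⟨t, ht, rfl⟩
    exact hmax ht
  choose τ hτI hτmax using hτ
  set a : ℕ → ℝ := fun j => ‖P.eval (σ (τ j))‖ with ha
  have ha0 : ∀ j, 0 ≤ a j := fun j => norm_nonneg _
  have haP : ∀ k < m, ∀ z ∈ arcPiece σ h k, ‖P.eval z‖ ≤ a k := fun k _ => hτmax k
  set V : ℕ → ℝ := fun j => (ν (arcPiece σ h j)).toReal ^ θ with hV
  have hV0 : ∀ j, 0 ≤ V j := fun j => Real.rpow_nonneg ENNReal.toReal_nonneg _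
  set B : ℕ → ℝ := fun j =>
    ∑ k ∈ Finset.range m, a k ^ p * ((1 + cycDist m j k) ^ (s₀ + 2))⁻¹ with hB
  have hlocal : ∀ j < m, ∀ ζ ∈ closedBall (σ (τ j)) h, ‖P.eval ζ‖ ^ p ≤ K * B j :=
    fun j hj ζ hζ => norm_eval_rpow_le_sum (by omega) hσ hΛ hΦ hn hP hh hm hmΛ hhd hp ha0 haP hj
      (mem_image_of_mem σ (hτI j)) hζ
  have hKB : ∀ j < m, 0 ≤ K * B j := fun j hj =>
    (Real.rpow_nonneg (norm_nonneg _) p).trans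
      (hlocal j hj _ (mem_closedBall_self hh.le))
  set M : ℕ → ℝ := fun j => (K * B j) ^ (1 / p) with hM
  have hM0 : ∀ j < m, 0 ≤ M j := fun j hj => Real.rpow_nonneg (hKB j hj) _
  have hMp : ∀ j < m, M j ^ p = K * B j := fun j hj => by
    rw [hM, ← Real.rpow_mul (hKB j hj), one_div_mul_cancel hp0.ne', Real.rpow_one]
  have hPM : ∀ j < m, ∀ ζ ∈ closedBall (σ (τ j)) h, ‖P.eval ζ‖ ≤ M j := fun j hj ζ hζ => by
    rw [← Real.rpow_le_rpow_iff (norm_nonneg _) (hM0 j hj) hp0, hMp j hj]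
    exact hlocal j hj ζ hζ
  set b : ℕ → ℝ := fun j => max (a j - 2 / 2 ^ i * M j) 0 with hb
  have hb0 : ∀ j, 0 ≤ b j := fun j => le_max_right _ _
  set X := ∑ j ∈ Finset.range m, a j ^ p * V j with hX
  have hX0 : 0 ≤ X := Finset.sum_nonneg fun j _ =>
    mul_nonneg (Real.rpow_nonneg (ha0 j) _) (hV0 j)
  have hXb : X ≤ 2 ^ (p + 1) * ∑ j ∈ Finset.range m, b j ^ p * V j := by
    have h1 : ∀ j ∈ Finset.range m,
        a j ^ p * V j ≤ 2 ^ p * (b j ^ p * V j) + 4 / 2 ^ i * K * (B j * V j) := by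
      intro j hj
      have hjm := Finset.mem_range.1 hj
      have h2 : a j ≤ b j + 2 / 2 ^ i * M j := by
        have := le_max_left (a j - 2 / 2 ^ i * M j) 0
        linarith
      have h3 := rpow_le_of_le_add (ha0 j) (hb0 j) (hM0 j hjm) (by positivity)
        (by rw [← mul_div_assoc, div_le_one (by positivity)]; linarith) hp h2
      rw [hMp j hjm] at h3
      calc a j ^ p * V j ≤ (2 ^ p * b j ^ p + 2 * (2 / 2 ^ i) * (K * B j)) * V j :=
            mul_le_mul_of_nonneg_right h3 (hV0 j)
        _ = _ := by ring
    have h2 := Finset.sum_le_sum h1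
    rw [Finset.sum_add_distrib, ← Finset.mul_sum, ← Finset.mul_sum] at h2
    have h3 : ∑ j ∈ Finset.range m, B j * V j ≤ 4 ^ s₀ * S * X :=
      sum_mul_sum_cycDist_le hσ hν hs₀.le hS hh hm hθ0.le hθ1
        (fun k => Real.rpow_nonneg (ha0 k) p)
    have h4 : 4 / 2 ^ i * K * ∑ j ∈ Finset.range m, B j * V j ≤ 1 / 2 * X := by
      calc 4 / 2 ^ i * K * ∑ j ∈ Finset.range m, B j * V j
          ≤ 4 / 2 ^ i * K * (4 ^ s₀ * S * X) := by gcongr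
        _ = 4 * (K * (4 ^ s₀ * S)) / 2 ^ i * X := by ring
        _ ≤ 1 / 2 * X := by
            refine mul_le_mul_of_nonneg_right ?_ hX0
            rw [div_le_iff₀ (by positivity)]
            linarith
    have h5 : (2:ℝ) ^ (p + 1) = 2 * 2 ^ p := by
      rw [Real.rpow_add two_pos, Real.rpow_one, mul_comm]
    rw [h5]
    linarith
  set Y := ∫ z in Γ, ‖P.eval z‖ ^ p * w z ^ θ ∂μH[1] with hY
  have hY0 : 0 ≤ Y := integral_nonneg fun z => by
    have := hw0 z
    positivity
  have hbY : c * h ^ (1 - θ) * ∑ j ∈ Finset.range m, b j ^ p * V j ≤ Y := by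
    have hJ : ∀ j : ℕ, ∃ J, MeasurableSet J ∧ (j < m → J ⊆ arcPiece σ h j ∧
        ENNReal.ofReal (c * h ^ (1 - θ) * (b j ^ p * V j)) ≤
          ∫⁻ z in J, ENNReal.ofReal (‖P.eval z‖ ^ p * w z ^ θ) ∂μH[1]) := by
      intro j
      by_cases hj : j < m
      · obtain ⟨J, h1, h2, h3⟩ := exists_subset_arcPiece_le_lintegral hσ hw hw0 hνw hν hp0 hθ0
          hθ1 hh hm hj (hτI j) (hPM j hj) hi1
        exact ⟨J, h1, fun _ => ⟨h2, h3⟩⟩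
      · exact ⟨∅, MeasurableSet.empty, fun h => absurd h hj⟩
    choose J hJm hJ using hJ
    rw [Finset.mul_sum]
    refine sum_le_integral_of_subset_arcPiece hσ hh hm (fun z => ?_)
      (integrableOn_rpow_mul_rpow hσ hw hw0 hνw P hp0.le hθ0.le hθ1) (fun j => ?_) hJm
      (fun j hj => (hJ j hj).1) (fun j hj => (hJ j hj).2)
    · have := hw0 z
      positivity
    · have := hb0 j
      have := hV0 j
      positivity
  have hleft : ∫ z in Γ, ‖P.eval z‖ ^ q * w z ∂μH[1] ≤ X ^ (q / p) := by
    refine (integral_rpow_mul_le_sum hσ hh hm hw hw0 hνw hq0.le ha0 haP).trans ?_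
    refine le_trans (le_of_eq (Finset.sum_congr rfl fun j _ => ?_))
      (sum_rpow_le_rpow_sum (Finset.range m)
        (fun j => mul_nonneg (Real.rpow_nonneg (ha0 j) p) (hV0 j)) ((one_le_div hp0).2 hpq.le))
    rw [Real.mul_rpow (Real.rpow_nonneg (ha0 j) _) (hV0 j), ← Real.rpow_mul (ha0 j), hV,
      ← Real.rpow_mul ENNReal.toReal_nonneg, hθ, mul_div_cancel₀ _ hp0.ne',
      div_mul_div_cancel₀ hq0.ne', div_self hp0.ne', Real.rpow_one]
  have hI0 : 0 ≤ ∫ z in Γ, ‖P.eval z‖ ^ q * w z ∂μH[1] := integral_nonneg fun z => by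
    have := hw0 z
    positivity
  have hXY : X ≤ 2 ^ (p + 1) / c * h ^ (θ - 1) * Y := by
    have h1 : h ^ (θ - 1) * h ^ (1 - θ) = 1 := by
      rw [← Real.rpow_add hh]
      simp
    calc X ≤ 2 ^ (p + 1) * ∑ j ∈ Finset.range m, b j ^ p * V j := hXb
      _ = 2 ^ (p + 1) / c * (h ^ (θ - 1) * h ^ (1 - θ)) *
          (c * ∑ j ∈ Finset.range m, b j ^ p * V j) := by
          rw [h1]
          field_simp
      _ = 2 ^ (p + 1) / c * h ^ (θ - 1) *
          (c * h ^ (1 - θ) * ∑ j ∈ Finset.range m, b j ^ p * V j) := by ring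
      _ ≤ _ := by gcongr
  calc (∫ z in Γ, ‖P.eval z‖ ^ q * w z ∂μH[1]) ^ (1 / q) ≤ (X ^ (q / p)) ^ (1 / q) := by gcongr
    _ = X ^ (1 / p) := by
        rw [← Real.rpow_mul hX0]
        congr 1
        field_simp
    _ ≤ (2 ^ (p + 1) / c * h ^ (θ - 1) * Y) ^ (1 / p) := by gcongr
    _ = (2 ^ (p + 1) / c) ^ (1 / p) * h ^ (1 / q - 1 / p) * Y ^ (1 / p) := by
        rw [Real.mul_rpow (by positivity) hY0, Real.mul_rpow (by positivity) (by positivity),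
          ← Real.rpow_mul hh.le]
        congr 3
        rw [hθ]
        field_simp

end Main

/-- weighted Nikolskii-type inequality, Theorem 3:
if `ν ∈ A∞(Γ)` has the form `dν = w ds` and `1 ≤ p < q < ∞`, then there are
`c₃ = c₃(Γ,p,q,λ_ν) > 0` and `n₁ = n₁(Γ)` such that for every `n > n₁` and `p_n ∈ ℙ_n`,
`(∫_Γ |p_n|^q w ds)^{1/q} ≤ c₃ d(Γ,Γ_{1/n})^{1/q-1/p} (∫_Γ |p_n|^p w^{p/q} ds)^{1/p}`. -/
theorem weighted_nikolskii_inequality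
    (Γ : Set ℂ) (Λ : ℝ) (hΓJ : IsJordanCurve Γ) (hΓq : IsQuasismooth Γ Λ)
    (lam : ℝ) (p q : ℝ) (hp : 1 ≤ p) (hpq : p < q)
    (Φ : ℂ → ℂ) (hΦ : IsExtConformal (unboundedComponent Γ) Φ) :
    ∃ c₃ > (0:ℝ), ∃ n₁ : ℕ,
      ∀ w : ℂ → ℝ, Measurable w → (∀ z, 0 ≤ w z) →
        IsAInftyMeasure Γ
          (((μH[1] : MeasureTheory.Measure ℂ).restrict Γ).withDensity
            (fun z => ENNReal.ofReal (w z))) lam →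
        IsFiniteMeasure
          (((μH[1] : MeasureTheory.Measure ℂ).restrict Γ).withDensity
            (fun z => ENNReal.ofReal (w z))) →
      ∀ (n : ℕ) (P : Polynomial ℂ),
        n₁ < n → P.natDegree ≤ n →
        (∫ z in Γ, ‖P.eval z‖ ^ q * w z ∂μH[1]) ^ (1/q) ≤
          c₃ * setDist Γ (levelCurve (unboundedComponent Γ) Φ (1/(n:ℝ))) ^ (1/q - 1/p) *
            (∫ z in Γ, ‖P.eval z‖ ^ p * w z ^ (p/q) ∂μH[1]) ^ (1/p) := by
  by_cases hlam : 1 ≤ lam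
  swap
  · exact ⟨1, one_pos, 0, fun w _ _ hν => absurd hν.1 hlam⟩
  obtain ⟨g, hg⟩ := hΓJ.exists_isPeriodicParam
  obtain ⟨L, σ, hσ⟩ := hg.exists_isArclengthParam hΓq
  have hL : 0 < L := hσ.pos
  have hΛ := hΓq.1
  obtain ⟨C, hC, hmain⟩ := exists_nikolskii_const hσ hΛ hΦ hlam hp hpq
  have hne : Γ.Nonempty := ⟨_, hg.apply_mem 0⟩
  obtain ⟨D, hD, hdD⟩ := hΦ.exists_setDist_le hne
  have hT : 0 < 2 * L + (Λ + 1) * D := by positivity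
  have hκ : 0 < L / (2 * L + (Λ + 1) * D) := by positivity
  set κ := L / (2 * L + (Λ + 1) * D) with hκdef
  have hexp : 1 / q - 1 / p ≤ 0 :=
    sub_nonpos.2 (one_div_le_one_div_of_le (by linarith) hpq.le)
  refine ⟨C * κ ^ (1 / q - 1 / p), by positivity, 0, fun w hw hw0 hν hfin n P hn hP => ?_⟩
  have hn1 : (1:ℝ) ≤ n := by exact_mod_cast hn
  have hδ : 0 < 1 / (n:ℝ) := by positivity
  have hd := hΦ.setDist_pos hg.isCompact hne hδ
  have hd' := hdD _ hδ ((div_le_one (by positivity)).2 hn1)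
  set d := setDist Γ (levelCurve (unboundedComponent Γ) Φ (1 / (n:ℝ))) with hddef
  obtain ⟨m, hm1, hm2⟩ : ∃ m : ℕ, max (2 * L / d) Λ ≤ m ∧ (m:ℝ) ≤ max (2 * L / d) Λ + 1 :=
    ⟨_, Nat.le_ceil _, (Nat.ceil_lt_add_one (le_max_of_le_right (by linarith))).le⟩
  have hmΛ : Λ ≤ m := (le_max_right _ _).trans hm1
  have hm0 : (0:ℝ) < m := by linarith
  have hmd : 2 * L ≤ m * d := (div_le_iff₀ hd).1 ((le_max_left _ _).trans hm1)
  have hmT : m * d ≤ 2 * L + (Λ + 1) * D := by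
    have h1 : max (2 * L / d) Λ ≤ 2 * L / d + Λ :=
      max_le (by linarith) (by have : 0 < 2 * L / d := by positivity
                               linarith)
    calc m * d ≤ (2 * L / d + (Λ + 1)) * d := by
          gcongr
          linarith
      _ = 2 * L + (Λ + 1) * d := by
          field_simp
      _ ≤ _ := by gcongr
  have hκh : κ * d ≤ L / m := by
    rw [hκdef, div_mul_eq_mul_div, div_le_div_iff₀ hT hm0]
    calc L * d * m = L * (m * d) := by ring
      _ ≤ _ := by gcongr
  have hhd : L / m < d := by
    rw [div_lt_iff₀ hm0]
    linarith
  calc _ ≤ C * (L / m) ^ (1 / q - 1 / p) *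
        (∫ z in Γ, ‖P.eval z‖ ^ p * w z ^ (p / q) ∂μH[1]) ^ (1 / p) :=
        hmain w _ hw hw0 rfl hν hfin n P hn hP m _ (by positivity)
          (mul_div_cancel₀ L hm0.ne') hmΛ hhd
    _ ≤ C * (κ ^ (1 / q - 1 / p) * d ^ (1 / q - 1 / p)) *
        (∫ z in Γ, ‖P.eval z‖ ^ p * w z ^ (p / q) ∂μH[1]) ^ (1 / p) := by
        have hI0 : 0 ≤ ∫ z in Γ, ‖P.eval z‖ ^ p * w z ^ (p / q) ∂μH[1] :=
          integral_nonneg fun z => by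
            have := hw0 z
            positivity
        rw [← Real.mul_rpow hκ.le hd.le]
        have := Real.rpow_le_rpow_of_nonpos (by positivity) hκh hexp
        gcongr
    _ = _ := by ring
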